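/- For every strongly normalizable untyped lambda term M with beta-eta normal form N, there exists a functional intersection type A such that ⊢ M : A is derivable in BCD, and N is the unique term in beta-eta normal form such that ⊢ N : A is derivable in BCD. -/

import Mathlib

/-! Common definitions: untyped lambda calculus (de Bruijn), beta/eta reduction,
BCD intersection types, derivations, Böhm-tree notions, numeral systems. -/

inductive Term : Type
  | var : ℕ → Term
  | app : Term → Term → Term
  | lam : Term → Term
  deriving DecidableEq

namespace Term

/-- Lift the free variables `≥ k` by `d`. -/
def lift (d : ℕ) : ℕ → Term → Term
  | k, var n => if n < k then var n else var (n + d)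
  | k, app s t => app (lift d k s) (lift d k t)
  | k, lam t => lam (lift d (k + 1) t)

/-- Substitute `u` for the free variable `k`. -/
def subst (u : Term) : ℕ → Term → Term
  | k, var n => if n = k then lift k 0 u else if k < n then var (n - 1) else var n
  | k, app s t => app (subst u k s) (subst u k t)
  | k, lam t => lam (subst u (k + 1) t)

/-- One-step beta reduction. -/
inductive Beta : Term → Term → Prop
  | beta (t u : Term) : Beta (app (lam t) u) (subst u 0 t)
  | appL {s s' : Term} (t : Term) : Beta s s' → Beta (app s t) (app s' t)
  | appR (s : Term) {t t' : Term} : Beta t t' → Beta (app s t) (app s t')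
  | lam {t t' : Term} : Beta t t' → Beta (lam t) (lam t')

/-- One-step eta reduction. -/
inductive Eta : Term → Term → Prop
  | eta (t : Term) : Eta (lam (app (lift 1 0 t) (var 0))) t
  | appL {s s' : Term} (t : Term) : Eta s s' → Eta (app s t) (app s' t)
  | appR (s : Term) {t t' : Term} : Eta t t' → Eta (app s t) (app s t')
  | lam {t t' : Term} : Eta t t' → Eta (lam t) (lam t')

/-- One-step beta-eta reduction. -/
def BetaEta (s t : Term) : Prop := Beta s t ∨ Eta s t

/-- Beta-eta conversion. -/
inductive Conv : Term → Term → Prop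
  | rel {s t : Term} : BetaEta s t → Conv s t
  | refl (t : Term) : Conv t t
  | symm {s t : Term} : Conv s t → Conv t s
  | trans {s t u : Term} : Conv s t → Conv t u → Conv s u

/-- Beta conversion. -/
inductive BetaConv : Term → Term → Prop
  | rel {s t : Term} : Beta s t → BetaConv s t
  | refl (t : Term) : BetaConv t t
  | symm {s t : Term} : BetaConv s t → BetaConv t s
  | trans {s t u : Term} : BetaConv s t → BetaConv t u → BetaConv s u

/-- Beta normal form. -/
def BetaNormal (t : Term) : Prop := ∀ u, ¬ Beta t u

/-- Beta-eta normal form. -/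
def BetaEtaNormal (t : Term) : Prop := ∀ u, ¬ BetaEta t u

/-- Strongly normalizable (with respect to beta reduction). -/
def SN (t : Term) : Prop := Acc (fun a b => Beta b a) t

/-- All free variables are `< k`. -/
def ClosedUnder : ℕ → Term → Prop
  | k, var n => n < k
  | k, app s t => ClosedUnder k s ∧ ClosedUnder k t
  | k, lam t => ClosedUnder (k + 1) t

/-- Closed term. -/
def Closed (t : Term) : Prop := ClosedUnder 0 t

/-- Length of the outermost lambda prefix. -/
def prefixLen : Term → ℕ
  | lam t => prefixLen t + 1
  | _ => 0

/-- Strip the outermost lambda prefix. -/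
def stripPrefix : Term → Term
  | lam t => stripPrefix t
  | t => t

/-- Head variable of an application spine. -/
def spineHead : Term → Option ℕ
  | var n => some n
  | app s _ => spineHead s
  | lam _ => none

/-- Arguments of an application spine. -/
def spineArgs : Term → List Term
  | app s t => spineArgs s ++ [t]
  | _ => []

/-- Head variable of a Böhm-tree node `λ x_1 ... x_k. x t_1 ... t_l`. -/
def headOf (t : Term) : Option ℕ := spineHead (stripPrefix t)

/-- Immediate descendants (the arguments) of a Böhm-tree node. -/
def argsOf (t : Term) : List Term := spineArgs (stripPrefix t)

/-- `Desc t d w` : `w` is a node of the Böhm tree of the beta-normal term `t`;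
`d` is the number of lambdas crossed strictly above (the root of) `w`. -/
inductive Desc : Term → ℕ → Term → Prop
  | refl (t : Term) : Desc t 0 t
  | step {t u w : Term} {d : ℕ} : u ∈ argsOf t → Desc u d w →
      Desc t (prefixLen t + d) w

/-- `Osc t l` : the Böhm tree of the beta-normal term `t` contains an oscillation
of length `l` whose first pair has the root of `t` as its first coordinate:
a node `λ x⃗.x` is paired with one of the arguments `u` of this occurrence of `x`
having a non-empty lambda prefix, and the next pair (if it exists) has the head
variable of its first coordinate `w` bound by the lambda prefix of `u`. -/
inductive Osc : Term → ℕ → Prop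
  | one {t u : Term} : u ∈ argsOf t → 0 < prefixLen u → Osc t 1
  | succ {t u w : Term} {d h l : ℕ} : u ∈ argsOf t → 0 < prefixLen u →
      Desc u d w → headOf w = some h →
      prefixLen w + d ≤ h + prefixLen u → h < prefixLen w + d →
      Osc w l → Osc t (l + 1)

/-- `X` has class `n` : every lambda prefix in the Böhm tree of `X` has at most `n`
lambdas, every node has at most `n` immediate descendants, and every oscillation
has length at most `n`. -/
def HasClass (n : ℕ) (X : Term) : Prop :=
  (∀ d w, Desc X d w → prefixLen w ≤ n ∧ (argsOf w).length ≤ n) ∧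
  (∀ d w l, Desc X d w → Osc w l → l ≤ n)

/-- Depth of the Böhm tree of a beta-normal term. -/
def tdepth : Term → ℕ
  | var _ => 0
  | lam t => tdepth t
  | app s t => max (tdepth s) (tdepth t + 1)

end Term

/-- `iterApp f n x = f (f ( ... (f x)))`, `n` times. -/
def iterApp (f : Term) : ℕ → Term → Term
  | 0, x => x
  | n + 1, x => Term.app f (iterApp f n x)

/-- Church numeral. -/
def church (n : ℕ) : Term := Term.lam (Term.lam (iterApp (Term.var 1) n (Term.var 0)))

/-- A fixed effective Gödel numbering of lambda terms. -/
def gnum : Term → ℕ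
  | Term.var n => Nat.pair 0 n
  | Term.app s t => Nat.pair 1 (Nat.pair (gnum s) (gnum t))
  | Term.lam t => Nat.pair 2 (gnum t)

/-- Intersection types (no top element). -/
inductive Ty : Type
  | atom : ℕ → Ty
  | arrow : Ty → Ty → Ty
  | inter : Ty → Ty → Ty
  deriving DecidableEq

namespace Ty

/-- The subtype preorder on intersection types (the "Traditional" system). -/
inductive Sub : Ty → Ty → Prop
  | refl (A : Ty) : Sub A A
  | trans {A B C : Ty} : Sub A B → Sub B C → Sub A C
  | interL (A B : Ty) : Sub (inter A B) A
  | interR (A B : Ty) : Sub (inter A B) B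
  | interGlb {C A B : Ty} : Sub C A → Sub C B → Sub C (inter A B)
  | arrow {A B C D : Ty} : Sub A C → Sub D B → Sub (arrow C D) (arrow A B)
  | dist (A B C : Ty) : Sub (inter (arrow A B) (arrow A C)) (arrow A (inter B C))

def IsInter : Ty → Prop
  | inter _ _ => True
  | _ => False

/-- Dist normal form: no subexpression of the shape `A → (B ∧ C)`. -/
def Dnf : Ty → Prop
  | atom _ => True
  | arrow A B => Dnf A ∧ Dnf B ∧ ¬ IsInter B
  | inter A B => Dnf A ∧ Dnf B

/-- `occ a s A` : the number of occurrences of the atom `a` in `A` whose sign is `s`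
(`true` = positive, `false` = negative); signs are preserved in the right argument
of `→` and in both arguments of `∧`, and flipped in the left argument of `→`. -/
def occ (a : ℕ) : Bool → Ty → ℕ
  | s, atom b => if s then (if a = b then 1 else 0) else 0
  | s, arrow C B => occ a (!s) C + occ a s B
  | s, inter C B => occ a s C + occ a s B

/-- `interOcc s A` : the number of occurrences of `∧` in `A` with sign `s`. -/
def interOcc : Bool → Ty → ℕ
  | _, atom _ => 0
  | s, arrow C B => interOcc (!s) C + interOcc s B
  | s, inter C B => (if s then 1 else 0) + interOcc s C + interOcc s B

/-- A type in dnf is functional if each atom occurs at most twice, any two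
occurrences of the same atom have opposite sign, and `∧` has no positive
occurrence. -/
def Functional (A : Ty) : Prop :=
  Dnf A ∧ (∀ a, occ a true A ≤ 1 ∧ occ a false A ≤ 1) ∧ interOcc true A = 0

/-- Co-functional: as `Functional` but `∧` has no negative occurrence. -/
def CoFunctional (A : Ty) : Prop :=
  Dnf A ∧ (∀ a, occ a true A ≤ 1 ∧ occ a false A ≤ 1) ∧ interOcc false A = 0

/-- Tropical evaluation of a type at the valuation `v` of the atom variables, at
sign `s`; `te v true A` is `e(A)` and `te v false A` is its dual `~e(A)`. -/
def te (v : ℕ → ℕ) : Bool → Ty → ℕ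
  | _, atom a => v a
  | s, arrow C B => 1 + te v (!s) C + te v s B
  | s, inter C B => if s then min (te v s C) (te v s B) else max (te v s C) (te v s B)

/-- slat congruence : the congruence generated by associativity and commutativity
of `∧` and idempotence `A ~ A ∧ A`. -/
inductive Slat : Ty → Ty → Prop
  | refl (A : Ty) : Slat A A
  | symm {A B : Ty} : Slat A B → Slat B A
  | trans {A B C : Ty} : Slat A B → Slat B C → Slat A C
  | assoc (A B C : Ty) : Slat (inter A (inter B C)) (inter (inter A B) C)
  | comm (A B : Ty) : Slat (inter A B) (inter B A)
  | idem (A : Ty) : Slat A (inter A A)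
  | arrowCong {A A' B B' : Ty} : Slat A A' → Slat B B' → Slat (arrow A B) (arrow A' B')
  | interCong {A A' B B' : Ty} : Slat A A' → Slat B B' → Slat (inter A B) (inter A' B')

/-- The `i`-th argument type along the arrows of a type. -/
def argTy : Ty → ℕ → Option Ty
  | arrow A _, 0 => some A
  | arrow _ B, n + 1 => argTy B n
  | _, _ => none

/-- The principal atoms (the end atoms of the components) of a type in dnf. -/
def principalAtoms : Ty → List ℕ
  | atom a => [a]
  | arrow _ B => principalAtoms B
  | inter A B => principalAtoms A ++ principalAtoms B

/-- All atoms occurring in a type. -/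
def atoms : Ty → List ℕ
  | atom a => [a]
  | arrow A B => atoms A ++ atoms B
  | inter A B => atoms A ++ atoms B

/-- `arrows [A₁, ..., Aₙ] B = A₁ → ( ... (Aₙ → B) ...)`. -/
def arrows (l : List Ty) (b : Ty) : Ty := l.foldr Ty.arrow b

end Ty

/-- One-hole contexts for types. -/
inductive Ctx : Type
  | hole : Ctx
  | arrowL : Ctx → Ty → Ctx
  | arrowR : Ty → Ctx → Ctx
  | interL : Ctx → Ty → Ctx
  | interR : Ty → Ctx → Ctx

namespace Ctx

/-- Fill the hole of a context with a type. -/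
def fill : Ctx → Ty → Ty
  | hole, A => A
  | arrowL C B, A => Ty.arrow (fill C A) B
  | arrowR B C, A => Ty.arrow B (fill C A)
  | interL C B, A => Ty.inter (fill C A) B
  | interR B C, A => Ty.inter B (fill C A)

/-- Sign of the hole of a context (`true` = positive occurrence). -/
def sign : Ctx → Bool
  | hole => true
  | arrowL C _ => !(sign C)
  | arrowR _ C => sign C
  | interL C _ => sign C
  | interR _ C => sign C

/-- The hole is strictly positive: it never passes through the left argument
of an `→`. -/
def strictPos : Ctx → Prop
  | hole => True
  | arrowL _ _ => False
  | arrowR _ C => strictPos C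
  | interL C _ => strictPos C
  | interR _ C => strictPos C

end Ctx

/-- The Munich system for the subtype relation. -/
inductive Munich : Ty → Ty → Prop
  | slat {A B : Ty} : Ty.Slat A B → Munich A B
  | distrib (E D : Ctx) (B C : Ty) : D.strictPos →
      Munich (E.fill (D.fill (Ty.inter B C))) (E.fill (Ty.inter (D.fill B) (D.fill C)))
  | posElim (E : Ctx) (B C : Ty) : E.sign = true →
      Munich (E.fill (Ty.inter B C)) (E.fill B)
  | negIntro (E : Ctx) (B C : Ty) : E.sign = false →
      Munich (E.fill B) (E.fill (Ty.inter B C))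
  | trans {A B C : Ty} : Munich A B → Munich B C → Munich A C

/-- BCD derivations (as proof trees). A basis is a finite list of types, the
variable `var n` receiving the `n`-th type of the list. -/
inductive Deriv : List Ty → Term → Ty → Type
  | var (Γ : List Ty) (n : ℕ) (A : Ty) : Γ[n]? = some A → Deriv Γ (Term.var n) A
  | lam (Γ : List Ty) (t : Term) (A B : Ty) :
      Deriv (A :: Γ) t B → Deriv Γ (Term.lam t) (Ty.arrow A B)
  | app (Γ : List Ty) (s t : Term) (A B : Ty) :
      Deriv Γ s (Ty.arrow A B) → Deriv Γ t A → Deriv Γ (Term.app s t) B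
  | inter (Γ : List Ty) (t : Term) (A B : Ty) :
      Deriv Γ t A → Deriv Γ t B → Deriv Γ t (Ty.inter A B)
  | sub (Γ : List Ty) (t : Term) (A B : Ty) :
      Deriv Γ t A → Ty.Sub A B → Deriv Γ t B

/-- BCD derivability. -/
def BCD (Γ : List Ty) (t : Term) (A : Ty) : Prop := Nonempty (Deriv Γ t A)

/-- All the types of a basis are in dist normal form. -/
def CtxDnf (Γ : List Ty) : Prop := ∀ B ∈ Γ, Ty.Dnf B

namespace Deriv

/-- Every type expression occurring in the derivation is in dist normal form. -/
def allDnf : {Γ : List Ty} → {t : Term} → {A : Ty} → Deriv Γ t A → Prop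
  | _, _, _, var Γ _ A _ => CtxDnf Γ ∧ Ty.Dnf A
  | _, _, _, lam _ _ A B d => Ty.Dnf (Ty.arrow A B) ∧ allDnf d
  | _, _, _, app _ _ _ _ _ d e => allDnf d ∧ allDnf e
  | _, _, _, inter _ _ _ _ d e => allDnf d ∧ allDnf e
  | _, _, _, sub _ _ _ B d _ => Ty.Dnf B ∧ allDnf d

/-- Every application of the subtyping rule has a variable as its subject. -/
def subOnVar : {Γ : List Ty} → {t : Term} → {A : Ty} → Deriv Γ t A → Prop
  | _, _, _, var _ _ _ _ => True
  | _, _, _, lam _ _ _ _ d => subOnVar d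
  | _, _, _, app _ _ _ _ _ d e => subOnVar d ∧ subOnVar e
  | _, _, _, inter _ _ _ _ d e => subOnVar d ∧ subOnVar e
  | _, _, _, sub _ t _ _ d _ => (∃ n, t = Term.var n) ∧ subOnVar d

/-- `temperate d m` : the derivation contains no intemperate sequence, where `m`
applications are pending above the root of `d`: no subtyping inference may
change an argument type at a position that is subsequently consumed by an
application. -/
def temperate : {Γ : List Ty} → {t : Term} → {A : Ty} → Deriv Γ t A → ℕ → Prop
  | _, _, _, var _ _ _ _, _ => True
  | _, _, _, lam _ _ _ _ d, _ => temperate d 0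
  | _, _, _, app _ _ _ _ _ d e, m => temperate d (m + 1) ∧ temperate e 0
  | _, _, _, inter _ _ _ _ d e, _ => temperate d 0 ∧ temperate e 0
  | _, _, _, sub _ _ A B d _, m =>
      (∀ i < m, Ty.argTy A i = Ty.argTy B i) ∧ temperate d m

/-- Almost minimal derivation. -/
def AM {Γ : List Ty} {t : Term} {A : Ty} (d : Deriv Γ t A) : Prop :=
  allDnf d ∧ subOnVar d ∧ temperate d 0

/-- `avoids d k` : the variable (currently of index) `k` is not used in the
derivation `d`. -/
def avoids : {Γ : List Ty} → {t : Term} → {A : Ty} → Deriv Γ t A → ℕ → Prop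
  | _, _, _, var _ n _ _, k => n ≠ k
  | _, _, _, lam _ _ _ _ d, k => avoids d (k + 1)
  | _, _, _, app _ _ _ _ _ d e, k => avoids d k ∧ avoids e k
  | _, _, _, inter _ _ _ _ d e, k => avoids d k ∧ avoids e k
  | _, _, _, sub _ _ _ _ d _, k => avoids d k

end Deriv

def Kterm : Term := Term.lam (Term.lam (Term.var 1))
def KstarTerm : Term := Term.lam (Term.lam (Term.var 0))

def applyList : Term → List Term → Term
  | M, [] => M
  | M, a :: l => applyList (Term.app M a) l

/-- Solvability of a closed term. -/
def Solvable (M : Term) : Prop :=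
  ∃ args : List Term, Term.Conv (applyList M args) (Term.lam (Term.var 0))

/-- A numeral system: a sequence of closed terms together with a successor `S`
and a zero test `Z`. -/
def NumeralSystem (d : ℕ → Term) : Prop :=
  (∀ n, Term.Closed (d n)) ∧
  ∃ S Z : Term, Term.Closed S ∧ Term.Closed Z ∧
    (∀ n, Term.Conv (Term.app S (d n)) (d (n + 1))) ∧
    Term.Conv (Term.app Z (d 0)) KstarTerm ∧
    (∀ n, 0 < n → Term.Conv (Term.app Z (d n)) Kterm)

/-- Lambda definability of a partial function on a numeral system. -/
def LambdaDefinableOn (d : ℕ → Term) (f : ℕ →. ℕ) : Prop :=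
  ∃ F : Term, Term.Closed F ∧
    (∀ n m, m ∈ f n → Term.Conv (Term.app F (d n)) (d m)) ∧
    (∀ n, ¬ (f n).Dom → ¬ Solvable (Term.app F (d n)))

/-- Adequacy: every partial recursive function is lambda definable on the system. -/
def Adequate (d : ℕ → Term) : Prop :=
  ∀ f : ℕ →. ℕ, Nat.Partrec f → LambdaDefinableOn d f

/-- `FG i r k` builds `f(λ x_{k+1}. f( ... f(λ x_n. x_i) ...))` with `r = n - k`
remaining levels, in the context `f, x_1, ..., x_k`. -/
def FG (i : ℕ) : ℕ → ℕ → Term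
  | 0, k => Term.var (k - i)
  | r + 1, k => Term.app (Term.var k) (Term.lam (FG i r (k + 1)))

/-- `Fterm i n = λ f. f(λ x₁. f(λ x₂. ... f(λ xₙ. x_i) ...))`. -/
def Fterm (i n : ℕ) : Term := Term.lam (FG i n 0)

/-- `X'` is an eta expansion of `X`. -/
def EtaExpandsTo (X X' : Term) : Prop :=
  Relation.ReflTransGen (fun a b => Term.Eta b a) X X'

/-- New normal form (for the parameter `n`): beta normal, every lambda prefix in
the Böhm tree has length `n+1` except the newly introduced eta variables (length
`0`), and every maximal oscillation has length `n+1`. -/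
def NewNF (n : ℕ) (X : Term) : Prop :=
  Term.BetaNormal X ∧
  (∀ d w, Term.Desc X d w → Term.prefixLen w = n + 1 ∨ Term.prefixLen w = 0) ∧
  (∀ d w l, Term.Desc X d w → Term.Osc w l → Term.Osc w (l + 1) ∨ l = n + 1)

/-- Having a beta normal form. -/
def HasBetaNF (M : Term) : Prop :=
  ∃ N, Relation.ReflTransGen Term.Beta M N ∧ Term.BetaNormal N

/-- The map taking a term of `S` to the Gödel number of its beta-eta normal form
is representable. -/
def GodelRepresentable (S : Set Term) : Prop :=
  ∃ M : Term, Term.Closed M ∧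
    ∀ N ∈ S, Term.BetaEtaNormal N → Term.Conv (Term.app M N) (church (gnum N))

/-- The set `S` (closed under beta-eta conversion) forms an adequate numeral
system. -/
def IsAdequateNumeralSystem (S : Set Term) : Prop :=
  ∃ d : ℕ → Term, NumeralSystem d ∧ Adequate d ∧
    (∀ n, d n ∈ S) ∧ (∀ M ∈ S, ∃ n, Term.Conv M (d n)) ∧
    (∀ n m, Term.Conv (d n) (d m) → n = m)


namespace Term

theorem lift_zero (k : ℕ) (t : Term) : lift 0 k t = t := by
  induction t generalizing k <;> simp_all [lift]

theorem lift_lift_comm (t : Term) (d d' : ℕ) {k c : ℕ} (h : k ≤ c) :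
    lift d' (c + d) (lift d k t) = lift d k (lift d' c t) := by
  induction t generalizing k c with
  | var n => simp only [lift]; split_ifs <;> simp only [lift] <;> grind
  | app s t ihs iht => simp only [lift, ihs h, iht h]
  | lam t ih =>
    have := ih (Nat.succ_le_succ h)
    simp only [lift, ← this]; congr 2; omega

theorem lift_lift_add (t : Term) (d d' : ℕ) {k c : ℕ} (h : k ≤ c) (h' : c ≤ k + d) :
    lift d' c (lift d k t) = lift (d + d') k t := by
  induction t generalizing k c with
  | var n => simp only [lift]; split_ifs <;> simp only [lift] <;> grind
  | app s t ihs iht => simp only [lift, ihs h h', iht h h']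
  | lam t ih => simp only [lift, ih (Nat.succ_le_succ h) (by omega)]

theorem lift_injective (d k : ℕ) {s t : Term} (h : lift d k s = lift d k t) : s = t := by
  induction s generalizing k t with
  | var n => cases t <;> simp only [lift] at h <;> grind
  | app s₁ s₂ ih₁ ih₂ =>
    cases t with
    | app t₁ t₂ => simp only [lift, app.injEq] at h; rw [ih₁ k h.1, ih₂ k h.2]
    | _ => simp only [lift] at h; grind
  | lam s ih =>
    cases t with
    | lam t => simp only [lift, lam.injEq] at h; rw [ih _ h]
    | _ => simp only [lift] at h; grind

theorem subst_lift_cancel (t u : Term) (d : ℕ) {k c : ℕ} (h : k ≤ c) (h' : c ≤ k + d) :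
    subst u c (lift (d + 1) k t) = lift d k t := by
  induction t generalizing k c with
  | var n => simp only [lift]; split_ifs <;> simp only [subst] <;> grind
  | app s t ihs iht => simp only [lift, subst, ihs h h', iht h h']
  | lam t ih => simp only [lift, subst, ih (Nat.succ_le_succ h) (by omega)]

theorem subst_lift_one (t u : Term) : subst u 0 (lift 1 0 t) = t := by
  rw [subst_lift_cancel t u 0 le_rfl le_rfl, lift_zero]

theorem lift_subst (t u : Term) (d k j : ℕ) :
    lift d (k + j) (subst u k t) = subst (lift d j u) k (lift d (k + j + 1) t) := by
  induction t generalizing k with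
  | var n =>
    rcases lt_trichotomy n k with h | h | h
    · simp [lift, subst, show n ≠ k by omega, show ¬ k < n by omega,
        show n < k + j + 1 by omega, show n < k + j by omega]
    · subst h
      simp only [lift, subst, if_true, show n < n + j + 1 by omega]
      rw [add_comm n j, lift_lift_comm _ _ _ (Nat.zero_le _)]
    · simp only [lift, subst, show n ≠ k by omega, h, if_true, if_false]
      split_ifs <;> simp only [subst] <;> grind
  | app s t ihs iht => simp only [lift, subst, ihs, iht]
  | lam t ih =>
    have := ih (k + 1)
    simp only [lift, subst, show k + j + 1 = k + 1 + j by omega, this]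

theorem subst_lift_comm (t u : Term) (d : ℕ) {c k : ℕ} (h : c ≤ k) :
    subst u (k + d) (lift d c t) = lift d c (subst u k t) := by
  induction t generalizing c k with
  | var n =>
    rcases lt_trichotomy n k with h1 | h1 | h1
    · simp only [lift, subst, show n ≠ k by omega, show ¬ k < n by omega, if_false]
      split_ifs <;> simp only [subst] <;> grind
    · subst h1
      simp only [lift, subst, if_true, show ¬ n < c by omega, if_false]
      rw [lift_lift_add _ _ _ (Nat.zero_le _) (by omega)]
    · simp only [lift, subst, show n ≠ k by omega, h1, if_true, if_false]
      split_ifs <;> simp only [subst] <;> grind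
  | app s t ihs iht => simp only [lift, subst, ihs h, iht h]
  | lam t ih =>
    have := ih (Nat.succ_le_succ h)
    simp only [lift, subst, ← this]; congr 2; omega

theorem subst_subst (t u v : Term) (k j : ℕ) :
    subst u (k + j) (subst v k t) = subst (subst u j v) k (subst u (k + j + 1) t) := by
  induction t generalizing k with
  | var n =>
    rcases lt_trichotomy n k with h | h | h
    · simp [subst, show n ≠ k by omega, show ¬ k < n by omega, show n ≠ k + j + 1 by omega,
        show ¬ k + j + 1 < n by omega, show n ≠ k + j by omega, show ¬ k + j < n by omega]
    · subst h
      simp only [subst, if_true, show n ≠ n + j + 1 by omega, show ¬ n + j + 1 < n by omega,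
        if_false]
      rw [add_comm n j, subst_lift_comm _ _ _ (Nat.zero_le _)]
    · rcases lt_trichotomy n (k + j + 1) with h1 | h1 | h1
      · simp [subst, show n ≠ k by omega, h, show n ≠ k + j + 1 by omega,
          show ¬ k + j + 1 < n by omega, show n - 1 ≠ k + j by omega,
          show ¬ k + j < n - 1 by omega]
      · subst h1
        simp only [subst, show k + j + 1 ≠ k by omega, h, if_true, if_false,
          show k + j + 1 - 1 = k + j by omega]
        rw [subst_lift_cancel _ _ _ (Nat.zero_le _) (by omega)]
      · simp [subst, show n ≠ k by omega, h, show n ≠ k + j + 1 by omega, h1,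
          show n - 1 ≠ k + j by omega, show k + j < n - 1 by omega,
          show n - 1 ≠ k by omega, show k < n - 1 by omega]
  | app s t ihs iht => simp only [subst, ihs, iht]
  | lam t ih =>
    have := ih (k + 1)
    simp only [subst, show k + j + 1 = k + 1 + j by omega, this]

theorem subst_var_lift (t : Term) (k : ℕ) : subst (var 0) k (lift 1 (k + 1) t) = t := by
  induction t generalizing k with
  | var n => simp only [lift]; split_ifs <;> simp only [subst] <;> grind [lift]
  | app s t ihs iht => simp only [lift, subst, ihs, iht]
  | lam t ih => simp only [lift, subst, ih]

theorem lift_eq_lift (a b : Term) (d : ℕ) {j k : ℕ} (hj : j ≤ k)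
    (h : lift d (k + 1) a = lift 1 j b) : ∃ c, a = lift 1 j c ∧ b = lift d k c := by
  induction a generalizing b j k with
  | var n =>
    cases b with
    | var m =>
      simp only [lift] at h
      by_cases hn : n < j
      · exact ⟨var n, by grind [lift], by grind [lift]⟩
      · exact ⟨var (n - 1), by grind [lift], by grind [lift]⟩
    | _ => simp only [lift] at h; grind
  | app s t ihs iht =>
    cases b with
    | app s' t' =>
      simp only [lift, app.injEq] at h
      obtain ⟨c₁, rfl, rfl⟩ := ihs _ hj h.1
      obtain ⟨c₂, rfl, rfl⟩ := iht _ hj h.2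
      exact ⟨app c₁ c₂, rfl, rfl⟩
    | _ => simp only [lift] at h; grind
  | lam t ih =>
    cases b with
    | lam t' =>
      simp only [lift, lam.injEq] at h
      obtain ⟨c, rfl, rfl⟩ := ih _ (Nat.succ_le_succ hj) h
      exact ⟨lam c, rfl, rfl⟩
    | _ => simp only [lift] at h; grind

end Term

namespace Term

open Relation

theorem lift_subst_zero (t u : Term) (d k : ℕ) :
    lift d k (subst u 0 t) = subst (lift d k u) 0 (lift d (k + 1) t) := by
  simpa using lift_subst t u d 0 k

theorem subst_subst_zero (t u v : Term) (k : ℕ) :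
    subst u k (subst v 0 t) = subst (subst u k v) 0 (subst u (k + 1) t) := by
  simpa using subst_subst t u v 0 k

/-- Parallel beta reduction. -/
inductive Par : Term → Term → Prop
  | var (n : ℕ) : Par (var n) (var n)
  | app {s s' t t' : Term} : Par s s' → Par t t' → Par (app s t) (app s' t')
  | lam {t t' : Term} : Par t t' → Par (lam t) (lam t')
  | beta {t t' u u' : Term} : Par t t' → Par u u' → Par (app (lam t) u) (subst u' 0 t')

theorem Par.refl (t : Term) : Par t t := by
  induction t with
  | var n => exact .var n
  | app s t ihs iht => exact .app ihs iht
  | lam t ih => exact .lam ih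

theorem Par.lift {t t' : Term} (h : Par t t') (d k : ℕ) :
    Par (Term.lift d k t) (Term.lift d k t') := by
  induction h generalizing k with
  | var n => exact .refl _
  | app _ _ ihs iht => exact .app (ihs k) (iht k)
  | lam _ ih => exact .lam (ih (k + 1))
  | beta _ _ iht ihu => rw [lift_subst_zero]; exact .beta (iht (k + 1)) (ihu k)

theorem Par.subst {t t' u u' : Term} (h : Par t t') (hu : Par u u') (k : ℕ) :
    Par (Term.subst u k t) (Term.subst u' k t') := by
  induction h generalizing k with
  | var n =>
    simp only [Term.subst]
    split_ifs
    · exact hu.lift k 0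
    · exact .refl _
    · exact .refl _
  | app _ _ ihs iht => exact .app (ihs k) (iht k)
  | lam _ ih => exact .lam (ih (k + 1))
  | beta _ _ iht ihu => rw [subst_subst_zero]; exact .beta (iht (k + 1)) (ihu k)

/-- Complete development. -/
def dev : Term → Term
  | var n => var n
  | lam t => lam (dev t)
  | app (lam t) u => subst (dev u) 0 (dev t)
  | app s t => app (dev s) (dev t)

theorem Par.to_dev {t t' : Term} (h : Par t t') : Par t' (dev t) := by
  induction h with
  | var n => exact .var n
  | lam _ ih => exact .lam ih
  | beta _ _ iht ihu => exact iht.subst ihu 0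
  | @app s s' t t' hs ht ihs iht =>
    cases s with
    | var n => exact .app ihs iht
    | app a b => exact .app ihs iht
    | lam a =>
      cases hs with
      | lam ha =>
        cases ihs with
        | lam iha => exact .beta iha iht

theorem Beta.par {t t' : Term} (h : Beta t t') : Par t t' := by
  induction h with
  | beta t u => exact .beta (.refl _) (.refl _)
  | appL t _ ih => exact .app ih (.refl _)
  | appR s _ ih => exact .app (.refl _) ih
  | lam _ ih => exact .lam ih

section Congruence

variable {R : Term → Term → Prop}

theorem rtg_app (hL : ∀ s s' t, R s s' → R (app s t) (app s' t))
    (hR : ∀ s t t', R t t' → R (app s t) (app s t')) {s s' t t' : Term}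
    (hs : ReflTransGen R s s') (ht : ReflTransGen R t t') :
    ReflTransGen R (app s t) (app s' t') :=
  (hs.lift (fun s => app s t) fun _ _ h => hL _ _ _ h).trans
    (ht.lift (fun t => app s' t) fun _ _ h => hR _ _ _ h)

end Congruence

theorem Par.betas {t t' : Term} (h : Par t t') : ReflTransGen Beta t t' := by
  induction h with
  | var n => exact .refl
  | app _ _ ihs iht => exact rtg_app (fun _ _ t => .appL t) (fun s _ _ => .appR s) ihs iht
  | lam _ ih => exact ih.lift Term.lam fun _ _ h => .lam h
  | beta _ _ iht ihu =>
    exact (rtg_app (fun _ _ t => .appL t) (fun s _ _ => .appR s)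
      (iht.lift Term.lam fun _ _ h => .lam h) ihu).tail (.beta _ _)

theorem beta_confluent {a b c : Term} (hb : ReflTransGen Beta a b) (hc : ReflTransGen Beta a c) :
    Join (ReflTransGen Beta) b c := by
  have toPar : ∀ {x y}, ReflTransGen Beta x y → ReflTransGen Par x y :=
    fun h => h.lift id fun _ _ h => h.par
  have ofPar : ∀ {x y}, ReflTransGen Par x y → ReflTransGen Beta x y := fun h => by
    induction h with
    | refl => exact .refl
    | tail _ h ih => exact ih.trans h.betas
  obtain ⟨d, h1, h2⟩ := church_rosser
    (fun a b c (hb : Par a b) (hc : Par a c) => ⟨dev a, .single hb.to_dev, .single hc.to_dev⟩)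
    (toPar hb) (toPar hc)
  exact ⟨d, ofPar h1, ofPar h2⟩

theorem Eta.lift {t t' : Term} (h : Eta t t') (d k : ℕ) :
    Eta (Term.lift d k t) (Term.lift d k t') := by
  induction h generalizing k with
  | eta t =>
    have := lift_lift_comm t 1 d (Nat.zero_le k)
    simp only [Term.lift, this, Nat.succ_pos, if_true]
    exact .eta _
  | appL t _ ih => exact .appL _ (ih k)
  | appR s _ ih => exact .appR _ (ih k)
  | lam _ ih => exact .lam (ih (k + 1))

theorem Eta.subst {t t' : Term} (h : Eta t t') (u : Term) (k : ℕ) :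
    Eta (Term.subst u k t) (Term.subst u k t') := by
  induction h generalizing k with
  | eta t =>
    have := subst_lift_comm t u 1 (Nat.zero_le k)
    simp only [Term.subst, this, Nat.zero_ne_add_one, Nat.not_lt_zero, if_false]
    exact .eta _
  | appL t _ ih => exact .appL _ (ih k)
  | appR s _ ih => exact .appR _ (ih k)
  | lam _ ih => exact .lam (ih (k + 1))

theorem Eta.subst_right {u u' : Term} (h : Eta u u') (t : Term) (k : ℕ) :
    ReflTransGen Eta (Term.subst u k t) (Term.subst u' k t) := by
  induction t generalizing k with
  | var n =>
    simp only [Term.subst]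
    split_ifs
    · exact .single (h.lift k 0)
    · exact .refl
    · exact .refl
  | app s t ihs iht => exact rtg_app (fun _ _ t => .appL t) (fun s _ _ => .appR s) (ihs k) (iht k)
  | lam t ih => exact (ih (k + 1)).lift Term.lam fun _ _ h => .lam h

theorem Beta.unlift {t s : Term} {d k : ℕ} (h : Beta (Term.lift d k t) s) :
    ∃ t', s = Term.lift d k t' ∧ Beta t t' := by
  induction t generalizing k s with
  | var n => simp only [Term.lift] at h; split_ifs at h <;> cases h
  | lam t ih =>
    simp only [Term.lift] at h
    cases h with
    | lam h => obtain ⟨t', rfl, h'⟩ := ih h; exact ⟨_, rfl, .lam h'⟩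
  | app a b iha ihb =>
    simp only [Term.lift] at h
    generalize ha : Term.lift d k a = a1 at h
    cases h with
    | beta a2 _ =>
      cases a with
      | var n => simp only [Term.lift] at ha; split_ifs at ha
      | app _ _ => simp [Term.lift] at ha
      | lam a =>
        simp only [Term.lift, lam.injEq] at ha
        exact ⟨_, by rw [← ha, ← lift_subst_zero], .beta _ _⟩
    | appL _ h => subst ha; obtain ⟨t', rfl, h'⟩ := iha h; exact ⟨app t' b, rfl, .appL _ h'⟩
    | appR _ h => subst ha; obtain ⟨t', rfl, h'⟩ := ihb h; exact ⟨app a t', rfl, .appR _ h'⟩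

theorem lift_eq_app {t a b : Term} {d k : ℕ} (h : lift d k t = app a b) :
    ∃ a' b', t = app a' b' ∧ lift d k a' = a ∧ lift d k b' = b := by
  cases t with
  | var n => simp only [lift] at h; split_ifs at h
  | app a' b' => simp only [lift, app.injEq] at h; exact ⟨_, _, rfl, h⟩
  | lam t => simp [lift] at h

theorem lift_eq_var_zero {t : Term} {d k : ℕ} (h : lift d (k + 1) t = var 0) : t = var 0 := by
  cases t with
  | var n => simp only [lift] at h; grind
  | app a' b' => simp [lift] at h
  | lam t => simp [lift] at h

theorem Eta.unlift {t s : Term} {d k : ℕ} (h : Eta (Term.lift d k t) s) :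
    ∃ t', s = Term.lift d k t' ∧ Eta t t' := by
  induction t generalizing k s with
  | var n => simp only [Term.lift] at h; split_ifs at h <;> cases h
  | lam t ih =>
    simp only [Term.lift] at h
    generalize ht : Term.lift d (k + 1) t = t1 at h
    cases h with
    | eta s =>
      obtain ⟨a, b, rfl, ha, hb⟩ := lift_eq_app ht
      obtain rfl := lift_eq_var_zero hb
      obtain ⟨c, rfl, rfl⟩ := lift_eq_lift _ _ _ (Nat.zero_le k) ha
      exact ⟨_, rfl, .eta _⟩
    | lam h => subst ht; obtain ⟨t', rfl, h'⟩ := ih h; exact ⟨_, rfl, .lam h'⟩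
  | app a b iha ihb =>
    simp only [Term.lift] at h
    cases h with
    | appL _ h => obtain ⟨t', rfl, h'⟩ := iha h; exact ⟨app t' b, rfl, .appL _ h'⟩
    | appR _ h => obtain ⟨t', rfl, h'⟩ := ihb h; exact ⟨app a t', rfl, .appR _ h'⟩

theorem Eta.of_expansion {t s : Term} (h : Eta (app (Term.lift 1 0 t) (var 0)) s) :
    ∃ t', s = app (Term.lift 1 0 t') (var 0) ∧ Eta t t' := by
  cases h with
  | appL _ h => obtain ⟨t', rfl, h'⟩ := h.unlift; exact ⟨t', rfl, h'⟩
  | appR _ h => cases h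

theorem eta_diamond {a b c : Term} (hb : Eta a b) (hc : Eta a c) :
    ∃ d, ReflGen Eta b d ∧ ReflGen Eta c d := by
  induction hb generalizing c with
  | eta t =>
    generalize hs : app (Term.lift 1 0 t) (var 0) = s at hc
    cases hc with
    | eta t' =>
      simp only [app.injEq, and_true] at hs
      obtain rfl := lift_injective _ _ hs
      exact ⟨_, .refl, .refl⟩
    | lam h =>
      subst hs
      obtain ⟨t', rfl, h'⟩ := h.of_expansion
      exact ⟨t', .single h', .single (.eta _)⟩
  | appL t h ih =>
    cases hc with
    | appL _ h' =>
      obtain ⟨d, h1, h2⟩ := ih h'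
      refine ⟨app d t, ?_, ?_⟩
      · cases h1 with
        | refl => exact .refl
        | single h => exact .single (.appL _ h)
      · cases h2 with
        | refl => exact .refl
        | single h => exact .single (.appL _ h)
    | appR _ h' => exact ⟨_, .single (.appR _ h'), .single (.appL _ h)⟩
  | appR s h ih =>
    cases hc with
    | appR _ h' =>
      obtain ⟨d, h1, h2⟩ := ih h'
      refine ⟨app s d, ?_, ?_⟩
      · cases h1 with
        | refl => exact .refl
        | single h => exact .single (.appR _ h)
      · cases h2 with
        | refl => exact .refl
        | single h => exact .single (.appR _ h)
    | appL _ h' => exact ⟨_, .single (.appL _ h'), .single (.appR _ h)⟩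
  | @lam s s' h ih =>
    cases hc with
    | eta t =>
      obtain ⟨t', rfl, h'⟩ := h.of_expansion
      exact ⟨t', .single (.eta _), .single h'⟩
    | lam h' =>
      obtain ⟨d, h1, h2⟩ := ih h'
      refine ⟨Term.lam d, ?_, ?_⟩
      · cases h1 with
        | refl => exact .refl
        | single h => exact .single (.lam h)
      · cases h2 with
        | refl => exact .refl
        | single h => exact .single (.lam h)

theorem eta_confluent {a b c : Term} (hb : ReflTransGen Eta a b) (hc : ReflTransGen Eta a c) :
    Join (ReflTransGen Eta) b c :=
  church_rosser (fun _ _ _ hb hc =>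
    have ⟨d, h1, h2⟩ := eta_diamond hb hc
    ⟨d, h1, h2.to_reflTransGen⟩) hb hc

theorem eta_beta_commute_step {a b c : Term} (hb : Eta a b) (hc : Beta a c) :
    ∃ d, ReflGen Beta b d ∧ ReflTransGen Eta c d := by
  induction hb generalizing c with
  | eta t =>
    cases hc with
    | lam h =>
      generalize hs : Term.lift 1 0 t = s at h
      cases h with
      | beta s _ =>
        cases t with
        | var n => simp only [Term.lift] at hs; split_ifs at hs
        | app _ _ => simp [Term.lift] at hs
        | lam t =>
          simp only [Term.lift, lam.injEq] at hs
          subst hs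
          rw [subst_var_lift]
          exact ⟨_, .refl, .refl⟩
      | appL _ h =>
        subst hs
        obtain ⟨t', rfl, h'⟩ := h.unlift
        exact ⟨t', .single h', .single (.eta _)⟩
      | appR _ h => cases h
  | @appL s s' t h ih =>
    cases hc with
    | beta b _ =>
      cases h with
      | eta t0 =>
        refine ⟨_, .refl, ?_⟩
        simp only [Term.subst, subst_lift_one, if_true, lift_zero]
        exact .refl
      | lam h => exact ⟨_, .single (.beta _ _), .single (h.subst _ _)⟩
    | appL _ h' =>
      obtain ⟨d, h1, h2⟩ := ih h'
      refine ⟨app d t, ?_, h2.lift (fun x => app x t) fun _ _ h => .appL _ h⟩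
      cases h1 with
      | refl => exact .refl
      | single h => exact .single (.appL _ h)
    | appR _ h' => exact ⟨_, .single (.appR _ h'), .single (.appL _ h)⟩
  | @appR s t t' h ih =>
    cases hc with
    | beta b _ => exact ⟨_, .single (.beta _ _), h.subst_right _ _⟩
    | appR _ h' =>
      obtain ⟨d, h1, h2⟩ := ih h'
      refine ⟨app s d, ?_, h2.lift (fun x => app s x) fun _ _ h => .appR _ h⟩
      cases h1 with
      | refl => exact .refl
      | single h => exact .single (.appR _ h)
    | appL _ h' => exact ⟨_, .single (.appL _ h'), .single (.appR _ h)⟩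
  | lam h ih =>
    cases hc with
    | lam h' =>
      obtain ⟨d, h1, h2⟩ := ih h'
      refine ⟨Term.lam d, ?_, h2.lift Term.lam fun _ _ h => .lam h⟩
      cases h1 with
      | refl => exact .refl
      | single h => exact .single (.lam h)

theorem eta_beta_commute {a b c : Term} (hb : ReflTransGen Eta a b) (hc : ReflTransGen Beta a c) :
    ∃ d, ReflTransGen Beta b d ∧ ReflTransGen Eta c d := by
  have strip : ∀ {a b c}, ReflTransGen Eta a b → Beta a c →
      ∃ d, ReflGen Beta b d ∧ ReflTransGen Eta c d := by
    intro a b c hb hc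
    induction hb with
    | refl => exact ⟨c, .single hc, .refl⟩
    | tail _ h ih =>
      obtain ⟨d, h1, h2⟩ := ih
      cases h1 with
      | refl => exact ⟨_, .refl, h2.tail h⟩
      | single h1 =>
        obtain ⟨e, h3, h4⟩ := eta_beta_commute_step h h1
        exact ⟨e, h3, h2.trans h4⟩
  induction hc with
  | refl => exact ⟨b, .refl, hb⟩
  | tail _ h ih =>
    obtain ⟨d, h1, h2⟩ := ih
    obtain ⟨e, h3, h4⟩ := strip h2 h
    exact ⟨e, h1.trans h3.to_reflTransGen, h4⟩

theorem betaEta_confluent {a b c : Term} (hb : ReflTransGen BetaEta a b)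
    (hc : ReflTransGen BetaEta a c) : Join (ReflTransGen BetaEta) b c := by
  let R : Term → Term → Prop := fun s t => ReflTransGen Beta s t ∨ ReflTransGen Eta s t
  have toR : ∀ {x y}, ReflTransGen BetaEta x y → ReflTransGen R x y :=
    fun h => h.lift id fun _ _ h => h.imp .single .single
  have ofR : ∀ {x y}, ReflTransGen R x y → ReflTransGen BetaEta x y := fun h => by
    induction h with
    | refl => exact .refl
    | tail _ h ih =>
      exact ih.trans (h.elim (fun h => ReflTransGen.mono (fun _ _ => Or.inl) _ _ h)
        fun h => ReflTransGen.mono (fun _ _ => Or.inr) _ _ h)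
  have diamond : ∀ a b c, R a b → R a c → ∃ d, ReflGen R b d ∧ ReflTransGen R c d := by
    rintro a b c (hb | hb) (hc | hc)
    · obtain ⟨d, h1, h2⟩ := beta_confluent hb hc
      exact ⟨d, .single (.inl h1), .single (.inl h2)⟩
    · obtain ⟨d, h1, h2⟩ := eta_beta_commute hc hb
      exact ⟨d, .single (.inr h2), .single (.inl h1)⟩
    · obtain ⟨d, h1, h2⟩ := eta_beta_commute hb hc
      exact ⟨d, .single (.inl h1), .single (.inr h2)⟩
    · obtain ⟨d, h1, h2⟩ := eta_confluent hb hc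
      exact ⟨d, .single (.inr h1), .single (.inr h2)⟩
  obtain ⟨d, h1, h2⟩ := church_rosser diamond (toR hb) (toR hc)
  exact ⟨d, ofR h1, ofR h2⟩

theorem Conv.join {s t : Term} (h : Conv s t) : Join (ReflTransGen BetaEta) s t := by
  induction h with
  | rel h => exact ⟨_, .single h, .refl⟩
  | refl t => exact ⟨t, .refl, .refl⟩
  | symm _ ih => obtain ⟨d, h1, h2⟩ := ih; exact ⟨d, h2, h1⟩
  | trans _ _ ih1 ih2 =>
    obtain ⟨d, h1, h2⟩ := ih1
    obtain ⟨e, h3, h4⟩ := ih2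
    obtain ⟨f, h5, h6⟩ := betaEta_confluent h2 h3
    exact ⟨f, h1.trans h5, h4.trans h6⟩

theorem Conv.reduces {s t : Term} (h : Conv s t) (ht : BetaEtaNormal t) :
    ReflTransGen BetaEta s t := by
  obtain ⟨d, h1, h2⟩ := h.join
  rcases h2.cases_head with rfl | ⟨e, he, _⟩
  · exact h1
  · exact absurd he (ht e)

theorem Conv.eq_of_normal {s t : Term} (h : Conv s t) (hs : BetaEtaNormal s)
    (ht : BetaEtaNormal t) : s = t := by
  rcases (h.reduces ht).cases_head with rfl | ⟨e, he, _⟩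
  · rfl
  · exact absurd he (hs e)

theorem Conv.app {s s' t t' : Term} (hs : Conv s s') (ht : Conv t t') :
    Conv (app s t) (app s' t') := by
  have h1 : ∀ u, Conv (.app s u) (.app s' u) := fun u => by
    induction hs with
    | rel h => exact .rel (h.imp (.appL _) (.appL _))
    | refl t => exact .refl _
    | symm _ ih => exact ih.symm
    | trans _ _ ih1 ih2 => exact ih1.trans ih2
  have h2 : ∀ u, Conv (.app u t) (.app u t') := fun u => by
    induction ht with
    | rel h => exact .rel (h.imp (.appR _) (.appR _))
    | refl t => exact .refl _
    | symm _ ih => exact ih.symm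
    | trans _ _ ih1 ih2 => exact ih1.trans ih2
  exact (h1 t).trans (h2 s')

theorem Conv.lam {t t' : Term} (h : Conv t t') : Conv (lam t) (lam t') := by
  induction h with
  | rel h => exact .rel (h.imp .lam .lam)
  | refl t => exact .refl _
  | symm _ ih => exact ih.symm
  | trans _ _ ih1 ih2 => exact ih1.trans ih2

end Term

namespace Ty

/-- The components of a type: it is equivalent to the intersection of them. -/
def comps : Ty → List Ty
  | atom a => [atom a]
  | arrow A B => (comps B).map (arrow A)
  | inter A B => comps A ++ comps B

/-- Subtyping between components. -/
inductive CSub : Ty → Ty → Prop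
  | atom (a : ℕ) : CSub (atom a) (atom a)
  | arrow {A A' B B' : Ty} : Sub A' A → CSub B B' → CSub (arrow A B) (arrow A' B')

theorem CSub.sub {A B : Ty} (h : CSub A B) : Sub A B := by
  induction h with
  | atom a => exact .refl _
  | arrow h _ ih => exact .arrow h ih

theorem CSub.trans {A B C : Ty} (h : CSub A B) (h' : CSub B C) : CSub A C := by
  induction h generalizing C with
  | atom a => exact h'
  | arrow h _ ih =>
    cases h' with
    | arrow h1 h2 => exact .arrow (h1.trans h) (ih h2)

theorem CSub.refl_of_mem {A C : Ty} (h : C ∈ comps A) : CSub C C := by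
  induction A generalizing C with
  | atom a => simp only [comps, List.mem_singleton] at h; subst h; exact .atom a
  | arrow A B _ ih =>
    simp only [comps, List.mem_map] at h
    obtain ⟨C, hC, rfl⟩ := h
    exact .arrow (.refl _) (ih hC)
  | inter A B iha ihb =>
    simp only [comps, List.mem_append] at h
    exact h.elim iha ihb

theorem Sub.comps {A B : Ty} (h : Sub A B) : ∀ D ∈ comps B, ∃ C ∈ comps A, CSub C D := by
  induction h with
  | refl A => exact fun D hD => ⟨D, hD, .refl_of_mem hD⟩
  | trans _ _ ih1 ih2 =>
    intro D hD
    obtain ⟨C, hC, h⟩ := ih2 D hD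
    obtain ⟨C', hC', h'⟩ := ih1 C hC
    exact ⟨C', hC', h'.trans h⟩
  | interL A B => exact fun D hD => ⟨D, List.mem_append_left _ hD, .refl_of_mem hD⟩
  | interR A B => exact fun D hD => ⟨D, List.mem_append_right _ hD, .refl_of_mem hD⟩
  | interGlb _ _ ih1 ih2 => exact fun D hD => (List.mem_append.1 hD).elim (ih1 D) (ih2 D)
  | arrow h _ _ ih =>
    intro D hD
    obtain ⟨E, hE, rfl⟩ := List.mem_map.1 hD
    obtain ⟨C, hC, h'⟩ := ih E hE
    exact ⟨_, List.mem_map_of_mem hC, .arrow h h'⟩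
  | dist A B C =>
    intro D hD
    exact ⟨D, by simpa [Ty.comps] using hD, .refl_of_mem hD⟩

theorem sub_of_mem_comps {A C : Ty} (h : C ∈ comps A) : Sub A C := by
  induction A generalizing C with
  | atom a => simp only [comps, List.mem_singleton] at h; subst h; exact .refl _
  | arrow A B _ ih =>
    simp only [comps, List.mem_map] at h
    obtain ⟨C, hC, rfl⟩ := h
    exact .arrow (.refl _) (ih hC)
  | inter A B iha ihb =>
    simp only [comps, List.mem_append] at h
    exact h.elim (fun h => (Sub.interL _ _).trans (iha h)) fun h => (Sub.interR _ _).trans (ihb h)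

theorem sub_arrows_inter (l : List Ty) (A B : Ty) :
    Sub (inter (arrows l A) (arrows l B)) (arrows l (inter A B)) := by
  induction l with
  | nil => exact .refl _
  | cons D l ih => exact (Sub.dist _ _ _).trans (.arrow (.refl _) ih)

theorem sub_arrows_of_comps {X B : Ty} (l : List Ty)
    (h : ∀ D ∈ comps B, Sub X (arrows l D)) : Sub X (arrows l B) := by
  induction B generalizing l with
  | atom a => exact h _ (by simp [comps])
  | arrow A B _ ih =>
    have e : ∀ D, arrows l (arrow A D) = arrows (l ++ [A]) D := fun D => by simp [arrows]
    rw [e]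
    exact ih _ fun D hD => e D ▸ h _ (List.mem_map_of_mem hD)
  | inter A B iha ihb =>
    exact (Sub.interGlb (iha l fun D hD => h D (List.mem_append_left _ hD))
      (ihb l fun D hD => h D (List.mem_append_right _ hD))).trans (sub_arrows_inter l A B)

end Ty

namespace BCD

open Ty

variable {Γ Δ : List Ty} {s t u : Term} {A B C : Ty}

theorem var {n : ℕ} (h : Γ[n]? = some A) : BCD Γ (.var n) A := ⟨.var _ _ _ h⟩

theorem lam (h : BCD (A :: Γ) t B) : BCD Γ (.lam t) (arrow A B) := h.elim fun d => ⟨.lam _ _ _ _ d⟩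

theorem app (h : BCD Γ s (arrow A B)) (h' : BCD Γ t A) : BCD Γ (.app s t) B :=
  h.elim fun d => h'.elim fun e => ⟨.app _ _ _ _ _ d e⟩

theorem inter (h : BCD Γ t A) (h' : BCD Γ t B) : BCD Γ t (inter A B) :=
  h.elim fun d => h'.elim fun e => ⟨.inter _ _ _ _ d e⟩

theorem sub (h : BCD Γ t A) (h' : Sub A B) : BCD Γ t B := h.elim fun d => ⟨.sub _ _ _ _ d h'⟩

theorem of_comps (hA : ∀ D ∈ comps A, ∃ E, BCD Γ t E ∧ Sub E D) : BCD Γ t A := by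
  have key : ∀ l : List Ty, l ≠ [] → (∀ D ∈ l, ∃ E, BCD Γ t E ∧ Sub E D) →
      ∃ X, BCD Γ t X ∧ ∀ D ∈ l, Sub X D := by
    intro l
    induction l with
    | nil => intro h; exact absurd rfl h
    | cons D l ih =>
      intro _ h
      obtain ⟨E, hE, hED⟩ := h D List.mem_cons_self
      rcases eq_or_ne l [] with rfl | hl
      · exact ⟨E, hE, by simpa using hED⟩
      · obtain ⟨X, hX, hXD⟩ := ih hl fun D hD => h D (List.mem_cons_of_mem _ hD)
        refine ⟨_, hE.inter hX, fun F hF => ?_⟩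
        rcases List.mem_cons.1 hF with rfl | hF
        · exact (Sub.interL _ _).trans hED
        · exact (Sub.interR _ _).trans (hXD F hF)
  have ne : ∀ A, comps A ≠ [] := fun A => by induction A <;> simp_all [comps]
  obtain ⟨X, hX, h⟩ := key _ (ne A) hA
  exact hX.sub (sub_arrows_of_comps [] h)

theorem var_iff {n : ℕ} : BCD Γ (.var n) A ↔ ∃ B, Γ[n]? = some B ∧ Sub B A := by
  refine ⟨?_, fun ⟨B, h, h'⟩ => (var h).sub h'⟩
  rintro ⟨d⟩
  generalize ht : Term.var n = t at d
  induction d with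
  | var Γ m A h => cases ht; exact ⟨A, h, .refl _⟩
  | inter Γ t A B _ _ ih1 ih2 =>
    obtain ⟨C, h1, h2⟩ := ih1 ht
    obtain ⟨C', h1', h2'⟩ := ih2 ht
    obtain rfl : C = C' := by rw [h1] at h1'; exact Option.some.inj h1'
    exact ⟨C, h1, .interGlb h2 h2'⟩
  | sub Γ t A B _ h ih =>
    obtain ⟨C, h1, h2⟩ := ih ht
    exact ⟨C, h1, h2.trans h⟩
  | _ => cases ht

theorem app_iff : BCD Γ (.app s t) A ↔ ∃ B, BCD Γ s (arrow B A) ∧ BCD Γ t B := by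
  refine ⟨?_, fun ⟨B, h, h'⟩ => h.app h'⟩
  rintro ⟨d⟩
  generalize hu : Term.app s t = u at d
  induction d with
  | app Γ s t A B d e => cases hu; exact ⟨A, ⟨d⟩, ⟨e⟩⟩
  | inter Γ t A B _ _ ih1 ih2 =>
    obtain ⟨C, h1, h2⟩ := ih1 hu
    obtain ⟨D, h1', h2'⟩ := ih2 hu
    refine ⟨.inter C D, .sub (.inter ?_ ?_) (.dist _ A B), h2.inter h2'⟩
    · exact h1.sub (.arrow (.interL _ _) (.refl _))
    · exact h1'.sub (.arrow (.interR _ _) (.refl _))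
  | sub Γ t A B _ h ih =>
    obtain ⟨C, h1, h2⟩ := ih hu
    exact ⟨C, h1.sub (.arrow (.refl _) h), h2⟩
  | _ => cases hu

/-- Pointwise subtyping of bases. -/
def CtxLe (Γ Δ : List Ty) : Prop := ∀ (n : ℕ) B, Δ[n]? = some B → ∃ A, Γ[n]? = some A ∧ Sub A B

theorem CtxLe.cons (h : CtxLe Γ Δ) (hA : Sub A B) : CtxLe (A :: Γ) (B :: Δ) := by
  intro n C hC
  cases n with
  | zero => simp only [List.getElem?_cons_zero, Option.some.injEq] at hC; exact ⟨A, rfl, hC ▸ hA⟩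
  | succ n => exact h n C hC

theorem CtxLe.refl (Γ : List Ty) : CtxLe Γ Γ := fun _ B hB => ⟨B, hB, .refl _⟩

theorem CtxLe.append (h : CtxLe Γ Δ) (l : List Ty) :
    CtxLe (l ++ Γ) (l ++ Δ) := by
  induction l with
  | nil => exact h
  | cons A l ih => exact ih.cons (.refl _)

theorem mono (h : BCD Δ t A) (hΓ : CtxLe Γ Δ) : BCD Γ t A := by
  obtain ⟨d⟩ := h
  induction d generalizing Γ with
  | var Δ n A h => obtain ⟨B, h1, h2⟩ := hΓ n A h; exact (var h1).sub h2
  | lam Δ t A B _ ih => exact lam (ih (hΓ.cons (.refl _)))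
  | app Δ s t A B _ _ ih1 ih2 => exact app (ih1 hΓ) (ih2 hΓ)
  | inter Δ t A B _ _ ih1 ih2 => exact inter (ih1 hΓ) (ih2 hΓ)
  | sub Δ t A B _ h ih => exact sub (ih hΓ) h

/-- The condition on `C` under which an abstraction with body `t` has type `C`. -/
def LamTy (Γ : List Ty) (t : Term) : Ty → Prop
  | .atom _ => False
  | .arrow A B => BCD (A :: Γ) t B
  | .inter A B => LamTy Γ t A ∧ LamTy Γ t B

theorem LamTy.sub (h : LamTy Γ t A) (h' : Sub A B) : LamTy Γ t B := by
  induction h' with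
  | refl A => exact h
  | trans _ _ ih1 ih2 => exact ih2 (ih1 h)
  | interL A B => exact h.1
  | interR A B => exact h.2
  | interGlb _ _ ih1 ih2 => exact ⟨ih1 h, ih2 h⟩
  | arrow h1 h2 _ _ => exact (BCD.mono h ((CtxLe.refl _).cons h1)).sub h2
  | dist A B C => exact BCD.inter h.1 h.2

theorem lam_iff : BCD Γ (.lam t) A ↔ LamTy Γ t A := by
  constructor
  · rintro ⟨d⟩
    generalize hu : Term.lam t = u at d
    induction d with
    | lam Γ t A B d => cases hu; exact ⟨d⟩
    | inter Γ t A B _ _ ih1 ih2 => exact ⟨ih1 hu, ih2 hu⟩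
    | sub Γ t A B _ h ih => exact (ih hu).sub h
    | _ => cases hu
  · intro h
    induction A with
    | atom a => exact h.elim
    | arrow A B => exact lam h
    | inter A B iha ihb => exact inter (iha h.1) (ihb h.2)

theorem lam_arrow_iff : BCD Γ (.lam t) (arrow A B) ↔ BCD (A :: Γ) t B := lam_iff

theorem LamTy.map (H : ∀ B C, BCD (B :: Γ) s C → BCD (B :: Δ) t C) (h : LamTy Γ s A) :
    LamTy Δ t A := by
  induction A with
  | atom a => exact h
  | arrow A B => exact H _ _ h
  | inter A B iha ihb => exact ⟨iha h.1, ihb h.2⟩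

theorem lift_iff (t : Term) (Γ Δ Θ : List Ty) (A : Ty) :
    BCD (Γ ++ (Δ ++ Θ)) (Term.lift Δ.length Γ.length t) A ↔ BCD (Γ ++ Θ) t A := by
  induction t generalizing Γ A with
  | var n =>
    simp only [Term.lift]
    split_ifs with h
    · simp [var_iff, List.getElem?_append, h]
    · have h1 : ¬ n + Δ.length < Γ.length := by omega
      have h2 : ¬ n + Δ.length - Γ.length < Δ.length := by omega
      have h3 : n + Δ.length - Γ.length - Δ.length = n - Γ.length := by omega
      simp [var_iff, List.getElem?_append, h, h1, h2, h3]
  | app s t ihs iht => simp only [Term.lift, app_iff, ihs, iht]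
  | lam t ih =>
    simp only [Term.lift, lam_iff]
    exact ⟨LamTy.map fun B C => (ih (B :: Γ) C).1, LamTy.map fun B C => (ih (B :: Γ) C).2⟩

theorem lift_one_iff : BCD (B :: Γ) (Term.lift 1 0 t) A ↔ BCD Γ t A := lift_iff t [] [B] Γ A

theorem subst_append {Θ : List Ty} (h : BCD (Γ ++ B :: Θ) t A) (hu : BCD Θ u B) :
    BCD (Γ ++ Θ) (Term.subst u Γ.length t) A := by
  induction t generalizing Γ A with
  | var n =>
    obtain ⟨C, h1, h2⟩ := var_iff.1 h
    refine BCD.sub ?_ h2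
    simp only [Term.subst]
    split_ifs with h3 h4
    · subst h3
      simp only [List.getElem?_append, lt_irrefl, if_false,
        Nat.sub_self, List.getElem?_cons_zero, Option.some.injEq] at h1
      subst h1
      exact (lift_iff u [] Γ Θ B).2 hu
    · refine var ?_
      rw [List.getElem?_append_right (by omega)] at h1 ⊢
      rw [show n - Γ.length = n - 1 - Γ.length + 1 by omega, List.getElem?_cons_succ] at h1
      exact h1
    · refine var ?_
      rw [List.getElem?_append_left (by omega)] at h1 ⊢
      exact h1
  | app s t ihs iht =>
    obtain ⟨C, h1, h2⟩ := app_iff.1 h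
    exact app (ihs h1) (iht h2)
  | lam t ih => exact lam_iff.2 ((lam_iff.1 h).map fun D C hC => ih (Γ := D :: Γ) hC)

theorem subst_zero (h : BCD (B :: Γ) t A) (hu : BCD Γ u B) : BCD Γ (Term.subst u 0 t) A :=
  subst_append (Γ := []) h hu

theorem of_subst_append {Θ : List Ty} (h : BCD (Γ ++ Θ) (Term.subst u Γ.length t) A)
    (hu : BCD Θ u C) : ∃ B, BCD Θ u B ∧ BCD (Γ ++ B :: Θ) t A := by
  have le : ∀ {Γ D E}, Sub D E → CtxLe (Γ ++ D :: Θ) (Γ ++ E :: Θ) :=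
    fun hs => CtxLe.append ((CtxLe.refl _).cons hs) _
  induction t generalizing Γ A with
  | var n =>
    simp only [Term.subst] at h
    split_ifs at h with h3 h4
    · subst h3
      refine ⟨A, (lift_iff u [] Γ Θ A).1 h, var ?_⟩
      simp
    · obtain ⟨D, h1, h2⟩ := var_iff.1 h
      refine ⟨C, hu, .sub (.var ?_) h2⟩
      rw [List.getElem?_append_right (by omega)] at h1 ⊢
      rw [show n - Γ.length = n - 1 - Γ.length + 1 by omega, List.getElem?_cons_succ]
      exact h1
    · obtain ⟨D, h1, h2⟩ := var_iff.1 h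
      refine ⟨C, hu, .sub (.var ?_) h2⟩
      have : n < Γ.length := by omega
      rw [List.getElem?_append_left this] at h1 ⊢
      exact h1
  | app s t ihs iht =>
    obtain ⟨D, h1, h2⟩ := app_iff.1 h
    obtain ⟨B1, hB1, h1⟩ := ihs h1
    obtain ⟨B2, hB2, h2⟩ := iht h2
    exact ⟨_, hB1.inter hB2, app (h1.mono (le (.interL _ _))) (h2.mono (le (.interR _ _)))⟩
  | lam t ih =>
    replace h := lam_iff.1 h
    induction A with
    | atom a => exact h.elim
    | arrow A B =>
      obtain ⟨D, hD, h'⟩ := ih (Γ := A :: Γ) h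
      exact ⟨D, hD, lam h'⟩
    | inter A B iha ihb =>
      obtain ⟨B1, hB1, h1⟩ := iha h.1
      obtain ⟨B2, hB2, h2⟩ := ihb h.2
      exact ⟨_, hB1.inter hB2,
        inter (h1.mono (le (.interL _ _))) (h2.mono (le (.interR _ _)))⟩

theorem of_subst_zero (h : BCD Γ (Term.subst u 0 t) A) (hu : BCD Γ u C) :
    BCD Γ (.app (.lam t) u) A := by
  obtain ⟨B, h1, h2⟩ := of_subst_append (Γ := []) h hu
  exact app (lam h2) h1

theorem beta (hst : Term.Beta s t) (h : BCD Γ s A) : BCD Γ t A := by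
  induction hst generalizing Γ A with
  | beta t u =>
    obtain ⟨B, h1, h2⟩ := app_iff.1 h
    exact subst_zero (lam_arrow_iff.1 h1) h2
  | appL t _ ih =>
    obtain ⟨B, h1, h2⟩ := app_iff.1 h
    exact app (ih h1) h2
  | appR s _ ih =>
    obtain ⟨B, h1, h2⟩ := app_iff.1 h
    exact app h1 (ih h2)
  | lam _ ih => exact lam_iff.2 ((lam_iff.1 h).map fun _ _ h => ih h)

theorem eta (hst : Term.Eta s t) (h : BCD Γ s A) : BCD Γ t A := by
  induction hst generalizing Γ A with
  | eta t =>
    replace h := lam_iff.1 h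
    induction A with
    | atom a => exact h.elim
    | arrow A B =>
      obtain ⟨C, h1, h2⟩ := app_iff.1 h
      obtain ⟨D, h3, h4⟩ := var_iff.1 h2
      simp only [List.getElem?_cons_zero, Option.some.injEq] at h3
      subst h3
      exact (lift_one_iff.1 h1).sub (.arrow h4 (.refl _))
    | inter A B iha ihb => exact inter (iha h.1) (ihb h.2)
  | appL t _ ih =>
    obtain ⟨B, h1, h2⟩ := app_iff.1 h
    exact app (ih h1) h2
  | appR s _ ih =>
    obtain ⟨B, h1, h2⟩ := app_iff.1 h
    exact app h1 (ih h2)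
  | lam _ ih => exact lam_iff.2 ((lam_iff.1 h).map fun _ _ h => ih h)

theorem betaEta (hst : Relation.ReflTransGen Term.BetaEta s t) (h : BCD Γ s A) : BCD Γ t A := by
  induction hst with
  | refl => exact h
  | tail _ h' ih => exact h'.elim (fun h' => beta h' ih) fun h' => eta h' ih

end BCD

namespace Term

open Relation

/-- Immediate subterms. -/
inductive ISub : Term → Term → Prop
  | appL (s t : Term) : ISub s (app s t)
  | appR (s t : Term) : ISub t (app s t)
  | lam (t : Term) : ISub t (lam t)

/-- `Smaller s t` : `s` is a beta reduct or an immediate subterm of `t`. -/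
def Smaller (s t : Term) : Prop := Beta t s ∨ ISub s t

theorem ISub.beta {s s' t : Term} (h : ReflTransGen ISub s t) (hs : Beta s s') :
    ∃ t', Beta t t' ∧ ReflTransGen ISub s' t' := by
  induction h with
  | refl => exact ⟨s', hs, .refl⟩
  | tail _ h ih =>
    obtain ⟨t', h1, h2⟩ := ih
    cases h with
    | appL _ t => exact ⟨_, .appL t h1, h2.tail (.appL _ _)⟩
    | appR s _ => exact ⟨_, .appR s h1, h2.tail (.appR _ _)⟩
    | lam _ => exact ⟨_, .lam h1, h2.tail (.lam _)⟩

theorem acc_smaller_of_subterm {s t : Term} (h : ReflTransGen ISub s t) (ht : Acc Smaller t) :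
    Acc Smaller s := by
  induction h with
  | refl => exact ht
  | tail _ h ih => exact ih (ht.inv (.inr h))

theorem SN.acc_smaller {t : Term} (h : SN t) : Acc Smaller t := by
  unfold SN at h
  induction h with
  | intro t _ ih =>
    have key : ∀ s, ReflTransGen ISub s t → Acc Smaller s := by
      intro s
      induction s with
      | var n =>
        exact fun _ => ⟨_, fun s hs => by rcases hs with hs | hs <;> cases hs⟩
      | lam a iha =>
        refine fun hst => ⟨_, fun s hs => ?_⟩
        rcases hs with hs | hs
        · obtain ⟨t', h1, h2⟩ := ISub.beta hst hs
          exact acc_smaller_of_subterm h2 (ih t' h1)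
        · cases hs with
          | lam => exact iha (hst.head (.lam _))
      | app a b iha ihb =>
        refine fun hst => ⟨_, fun s hs => ?_⟩
        rcases hs with hs | hs
        · obtain ⟨t', h1, h2⟩ := ISub.beta hst hs
          exact acc_smaller_of_subterm h2 (ih t' h1)
        · cases hs with
          | appL => exact iha (hst.head (.appL _ _))
          | appR => exact ihb (hst.head (.appR _ _))
    exact key t .refl

/-- The head of the application spine is a variable. -/
def HeadVar : Term → Prop
  | var _ => True
  | app s _ => HeadVar s
  | lam _ => False

/-- `HeadStep u s s'` : `s'` is obtained from `s` by contracting a beta redex with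
argument `u` at the head of the application spine. -/
inductive HeadStep (u : Term) : Term → Term → Prop
  | beta (t : Term) : HeadStep u (app (lam t) u) (subst u 0 t)
  | app {s s' : Term} (t : Term) : HeadStep u s s' → HeadStep u (app s t) (app s' t)

theorem headVar_or_headStep (s t : Term) : HeadVar s ∨ ∃ u r, HeadStep u (app s t) r := by
  induction s generalizing t with
  | var n => exact .inl trivial
  | lam s => exact .inr ⟨_, _, .beta s⟩
  | app a b iha _ => exact (iha b).imp id fun ⟨u, r, h⟩ => ⟨u, _, .app t h⟩

theorem HeadStep.toBeta {u s s' : Term} (h : HeadStep u s s') : Beta s s' := by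
  induction h with
  | beta t => exact .beta t u
  | app t _ ih => exact .appL t ih

theorem HeadStep.subterm {u s s' : Term} (h : HeadStep u s s') : TransGen ISub u s := by
  induction h with
  | beta t => exact .single (.appR _ _)
  | app t _ ih => exact ih.tail (.appL _ _)

theorem HeadStep.bcd {u s s' : Term} {Γ : List Ty} {A C : Ty} (h : HeadStep u s s')
    (hs : BCD Γ s' A) (hu : BCD Γ u C) : BCD Γ s A := by
  induction h generalizing A with
  | beta t => exact BCD.of_subst_zero hs hu
  | app t _ ih =>
    obtain ⟨B, h1, h2⟩ := BCD.app_iff.1 hs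
    exact BCD.app (ih h1) h2

theorem ClosedUnder.lift {t : Term} {n d k : ℕ} (h : ClosedUnder n t) :
    ClosedUnder (n + d) (Term.lift d k t) := by
  induction t generalizing n k with
  | var m => simp only [Term.lift, ClosedUnder] at *; split_ifs <;> simp only [ClosedUnder] <;> omega
  | app s t ihs iht => exact ⟨ihs h.1, iht h.2⟩
  | lam t ih =>
    have := ih (k := k + 1) h
    rw [show n + 1 + d = n + d + 1 by omega] at this
    exact this

theorem ClosedUnder.subst {t u : Term} {n k : ℕ} (h : ClosedUnder (n + k + 1) t)
    (hu : ClosedUnder n u) : ClosedUnder (n + k) (Term.subst u k t) := by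
  induction t generalizing k with
  | var m =>
    simp only [Term.subst]
    split_ifs
    · exact hu.lift
    · simp only [ClosedUnder] at *; omega
    · simp only [ClosedUnder] at *; omega
  | app s t ihs iht => exact ⟨ihs h.1, iht h.2⟩
  | lam t ih => exact ih (k := k + 1) h

theorem HeadStep.closedUnder {u s s' : Term} {n : ℕ} (h : HeadStep u s s')
    (hs : ClosedUnder n s) : ClosedUnder n s' ∧ ClosedUnder n u := by
  induction h with
  | beta t => exact ⟨ClosedUnder.subst (k := 0) hs.1 hs.2, hs.2⟩
  | app t _ ih => exact ⟨⟨(ih hs.1).1, hs.2⟩, (ih hs.1).2⟩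

end Term

namespace Ty

/-- Types in dist normal form without `∧` at sign `s`. -/
def Good : Bool → Ty → Prop
  | _, atom _ => True
  | s, arrow A B => Good (!s) A ∧ Good s B ∧ ¬ IsInter B
  | s, inter A B => s = false ∧ Good s A ∧ Good s B

theorem good_iff {s : Bool} {A : Ty} : Good s A ↔ Dnf A ∧ interOcc s A = 0 := by
  induction A generalizing s with
  | atom a => simp [Good, Dnf, interOcc]
  | arrow A B iha ihb => simp only [Good, Dnf, interOcc, iha, ihb]; grind
  | inter A B iha ihb => cases s <;> simp [Good, Dnf, interOcc, iha, ihb]; grind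

theorem Good.not_isInter {A : Ty} (h : Good true A) : ¬ IsInter A := by
  cases A <;> simp_all [Good, IsInter]

/-- The number of occurrences of the atom `a` with sign `s` in the types of a basis. -/
def ctxOcc (a : ℕ) (s : Bool) (Γ : List Ty) : ℕ := (Γ.map (occ a s)).sum

/-- The basis `Γ` and the type `A` satisfy the conditions making `Γ₁ → ... → Γₙ → A`
functional. -/
structure FunSeq (Γ : List Ty) (A : Ty) : Prop where
  ctx : ∀ B ∈ Γ, Good false B
  goal : Good true A
  occ_le : ∀ a s, ctxOcc a (!s) Γ + occ a s A ≤ 1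

theorem FunSeq.functional {A : Ty} (h : FunSeq [] A) : Functional A := by
  obtain ⟨h1, h2⟩ := good_iff.1 h.goal
  have := h.occ_le
  simp only [ctxOcc, List.map_nil, List.sum_nil, zero_add] at this
  exact ⟨h1, fun a => ⟨this a true, this a false⟩, h2⟩

/-- Pointwise intersection of bases. -/
def meet (Γ Δ : List Ty) : List Ty := List.zipWith inter Γ Δ

theorem length_meet {Γ Δ : List Ty} (h : Γ.length = Δ.length) : (meet Γ Δ).length = Γ.length := by
  simp [meet, h]

theorem ctxOcc_meet {Γ Δ : List Ty} (h : Γ.length = Δ.length) (a : ℕ) (s : Bool) :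
    ctxOcc a s (meet Γ Δ) = ctxOcc a s Γ + ctxOcc a s Δ := by
  induction Γ generalizing Δ with
  | nil => cases Δ <;> simp_all [meet, ctxOcc]
  | cons A Γ ih =>
    cases Δ with
    | nil => simp at h
    | cons B Δ =>
      have := ih (Δ := Δ) (by simpa using h)
      simp only [ctxOcc, meet, List.zipWith_cons_cons, List.map_cons, List.sum_cons, occ] at *
      omega

theorem good_meet {Γ Δ : List Ty} (hΓ : ∀ B ∈ Γ, Good false B) (hΔ : ∀ B ∈ Δ, Good false B) :
    ∀ B ∈ meet Γ Δ, Good false B := by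
  intro B hB
  obtain ⟨i, hi, rfl⟩ := List.getElem_of_mem hB
  simp only [meet, List.getElem_zipWith]
  exact ⟨rfl, hΓ _ (List.getElem_mem _), hΔ _ (List.getElem_mem _)⟩

theorem ctxLe_meet_left {Γ Δ : List Ty} (h : Γ.length = Δ.length) : BCD.CtxLe (meet Γ Δ) Γ := by
  intro n B hB
  obtain ⟨hn, rfl⟩ := List.getElem?_eq_some_iff.1 hB
  exact ⟨inter Γ[n] Δ[n], by simp [meet, h ▸ hn, hn], .interL _ _⟩

theorem ctxLe_meet_right {Γ Δ : List Ty} (h : Γ.length = Δ.length) : BCD.CtxLe (meet Γ Δ) Δ := by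
  intro n B hB
  obtain ⟨hn, rfl⟩ := List.getElem?_eq_some_iff.1 hB
  exact ⟨inter Γ[n] Δ[n], by simp [meet, h ▸ hn, hn], .interR _ _⟩

theorem exists_fresh_ctx (n m : ℕ) : ∃ (Γ : List Ty) (m' : ℕ), m ≤ m' ∧ Γ.length = n ∧
    (∀ B ∈ Γ, Good false B) ∧ (∀ a s, a < m → ctxOcc a s Γ = 0) ∧ (∀ a s, ctxOcc a s Γ ≤ 1) ∧
    (∀ a s, m' ≤ a → ctxOcc a s Γ = 0) := by
  induction n generalizing m with
  | zero => exact ⟨[], m, le_rfl, rfl, by simp, by simp [ctxOcc], by simp [ctxOcc], by simp [ctxOcc]⟩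
  | succ n ih =>
    obtain ⟨Γ, m', h1, h2, h3, h4, h5, h6⟩ := ih (m + 1)
    refine ⟨atom m :: Γ, m', by omega, by simp [h2], ?_, fun a s ha => ?_, fun a s => ?_,
      fun a s ha => ?_⟩
    · simpa [Good] using h3
    · have := h4 a s (by omega)
      simp only [ctxOcc, List.map_cons, List.sum_cons, occ] at *
      split_ifs <;> omega
    · have h := h5 a s
      have h' := h4 a s
      simp only [ctxOcc, List.map_cons, List.sum_cons, occ] at *
      split_ifs <;> omega
    · have := h6 a s ha
      simp only [ctxOcc, List.map_cons, List.sum_cons, occ] at *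
      split_ifs <;> omega

theorem exists_ctx_of_var {n x : ℕ} (hx : x < n) (m : ℕ) {B : Ty} (hB : Good false B)
    (hm : ∀ a s, m ≤ a → occ a s B = 0) : ∃ (Γ : List Ty) (m' : ℕ), m ≤ m' ∧ Γ.length = n ∧
    (∀ B ∈ Γ, Good false B) ∧ Γ[x]? = some B ∧ (∀ a s, a < m → ctxOcc a s Γ = occ a s B) ∧
    (∀ a s, m ≤ a → ctxOcc a s Γ ≤ 1) ∧ (∀ a s, m' ≤ a → ctxOcc a s Γ = 0) := by
  induction x generalizing n m with
  | zero =>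
    obtain ⟨n, rfl⟩ := Nat.exists_eq_add_one_of_ne_zero hx.ne'
    obtain ⟨Γ, m', h1, h2, h3, h4, h5, h6⟩ := exists_fresh_ctx n m
    refine ⟨B :: Γ, m', h1, by simp [h2], by simpa [hB] using h3, rfl, fun a s ha => ?_,
      fun a s ha => ?_, fun a s ha => ?_⟩
    · have := h4 a s ha
      simp only [ctxOcc, List.map_cons, List.sum_cons] at *
      omega
    · have := h5 a s
      have := hm a s ha
      simp only [ctxOcc, List.map_cons, List.sum_cons] at *
      omega
    · have := h6 a s ha
      have := hm a s (by omega)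
      simp only [ctxOcc, List.map_cons, List.sum_cons] at *
      omega
  | succ x ih =>
    obtain ⟨n, rfl⟩ := Nat.exists_eq_add_one_of_ne_zero (by omega : n ≠ 0)
    obtain ⟨Γ, m', h1, h2, h3, h4, h5, h6, h7⟩ :=
      ih (n := n) (by omega) (m + 1) fun a s ha => hm a s (by omega)
    refine ⟨atom m :: Γ, m', by omega, by simp [h2], ?_, h4, fun a s ha => ?_, fun a s ha => ?_,
      fun a s ha => ?_⟩
    · simpa [Good] using h3
    · have := h5 a s (by omega)
      simp only [ctxOcc, List.map_cons, List.sum_cons, occ] at *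
      split_ifs <;> omega
    · have h := h6 a s
      have h' := h5 a s
      have := hm a s ha
      simp only [ctxOcc, List.map_cons, List.sum_cons, occ] at *
      split_ifs <;> omega
    · have := h7 a s ha
      simp only [ctxOcc, List.map_cons, List.sum_cons, occ] at *
      split_ifs <;> omega

end Ty

namespace Term

open Ty Relation

/-- `t` has a functional typing with atoms in any final segment of the natural numbers. -/
def FunTypable (t : Term) : Prop :=
  ∀ n m, ClosedUnder n t → ∃ (Γ : List Ty) (A : Ty) (m' : ℕ), m ≤ m' ∧ Γ.length = n ∧ BCD Γ t A ∧
    FunSeq Γ A ∧ ∀ a s, a < m ∨ m' ≤ a → ctxOcc a (!s) Γ + occ a s A = 0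

/-- `t` can be assigned every type `B`, in a basis where only the occurrences of the atoms
of `B` are those of `B`. -/
def SpineTypable (t : Term) : Prop :=
  ∀ n m B, ClosedUnder n t → Good false B → ¬ IsInter B → (∀ a s, m ≤ a → occ a s B = 0) →
    ∃ (Γ : List Ty) (m' : ℕ), m ≤ m' ∧ Γ.length = n ∧ (∀ B ∈ Γ, Good false B) ∧ BCD Γ t B ∧
    (∀ a s, a < m → ctxOcc a s Γ = occ a s B) ∧ (∀ a s, m ≤ a → ctxOcc a s Γ ≤ 1) ∧
    (∀ a s, m' ≤ a → ctxOcc a s Γ = 0)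

theorem spineTypable_var (x : ℕ) : SpineTypable (var x) := by
  intro n m B hx hB _ hm
  obtain ⟨Γ, m', h1, h2, h3, h4, h5⟩ := exists_ctx_of_var hx m hB hm
  exact ⟨Γ, m', h1, h2, h3, BCD.var h4, h5⟩

theorem SpineTypable.app {s t : Term} (hs : SpineTypable s) (ht : FunTypable t) :
    SpineTypable (app s t) := by
  intro n m B hn hB hB' hm
  obtain ⟨Δ, A, m1, h1, h2, h3, h4, h5⟩ := ht n m hn.2
  obtain ⟨Γ, m2, g1, g2, g3, g4, g5, g6, g7⟩ := hs n m1 (arrow A B) hn.1 ⟨h4.goal, hB, hB'⟩ id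
    fun a s ha => by
      have := h5 a (!s) (.inr ha)
      have := hm a s (by omega)
      simp only [occ]; omega
  have hl : Γ.length = Δ.length := by omega
  refine ⟨meet Γ Δ, m2, by omega, by rw [length_meet hl, g2], good_meet g3 h4.ctx,
    BCD.app (g4.mono (ctxLe_meet_left hl)) (h3.mono (ctxLe_meet_right hl)), fun a s ha => ?_,
    fun a s ha => ?_, fun a s ha => ?_⟩
  all_goals
    rw [ctxOcc_meet hl]
    have e1 := h5 a (!s)
    have e2 := h4.occ_le a (!s)
    have e3 := g5 a s
    have e4 := g6 a s
    have e5 := g7 a s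
    have e6 := hm a s
    simp only [occ, Bool.not_not] at *
    rcases lt_or_ge a m1 with h | h <;> grind

theorem SpineTypable.funTypable {t : Term} (ht : SpineTypable t) : FunTypable t := by
  intro n m hn
  obtain ⟨Γ, m', h1, h2, h3, h4, h5, h6, h7⟩ := ht n (m + 1) (atom m) hn trivial id
    fun a s ha => by simp only [occ]; split_ifs <;> omega
  refine ⟨Γ, atom m, m', by omega, h2, h4, ⟨h3, trivial, fun a s => ?_⟩, fun a s ha => ?_⟩
  all_goals
    have e1 := h5 a (!s)
    have e2 := h6 a (!s)
    have e3 := h7 a (!s)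
    cases s <;> simp only [occ] at * <;> grind

theorem FunTypable.lam {t : Term} (ht : FunTypable t) : FunTypable (lam t) := by
  intro n m hn
  obtain ⟨Γ, A, m', h1, h2, h3, h4, h5⟩ := ht (n + 1) m hn
  cases Γ with
  | nil => simp at h2
  | cons B Γ =>
    have e : ∀ a s, ctxOcc a (!s) Γ + occ a s (arrow B A) =
        ctxOcc a (!s) (B :: Γ) + occ a s A := fun a s => by
      simp only [ctxOcc, List.map_cons, List.sum_cons, occ]; omega
    refine ⟨Γ, arrow B A, m', h1, by simpa using h2, BCD.lam h3, ⟨?_, ⟨?_, h4.goal, ?_⟩, ?_⟩, ?_⟩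
    · exact fun C hC => h4.ctx C (List.mem_cons_of_mem _ hC)
    · exact h4.ctx B List.mem_cons_self
    · exact h4.goal.not_isInter
    · exact fun a s => e a s ▸ h4.occ_le a s
    · exact fun a s ha => e a s ▸ h5 a s ha

theorem FunTypable.of_headStep {s s' u : Term} (h : HeadStep u s s') (hs : FunTypable s')
    (hu : FunTypable u) : FunTypable s := by
  intro n m hn
  obtain ⟨Δ, C, m1, h1, h2, h3, h4, h5⟩ := hu n m (h.closedUnder hn).2
  obtain ⟨Γ, A, m2, g1, g2, g3, g4, g5⟩ := hs n m1 (h.closedUnder hn).1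
  have hl : Γ.length = Δ.length := by omega
  refine ⟨meet Γ Δ, A, m2, by omega, by rw [length_meet hl, g2],
    h.bcd (g3.mono (ctxLe_meet_left hl)) (h3.mono (ctxLe_meet_right hl)),
    ⟨good_meet g4.ctx h4.ctx, g4.goal, fun a s => ?_⟩, fun a s ha => ?_⟩
  all_goals
    rw [ctxOcc_meet hl]
    have e1 := h5 a s
    have e2 := h4.occ_le a s
    have e3 := g5 a s
    have e4 := g4.occ_le a s
    rcases lt_or_ge a m1 with h | h <;> grind

theorem SN.funTypable {t : Term} (h : SN t) : FunTypable t := by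
  suffices FunTypable t ∧ (HeadVar t → SpineTypable t) from this.1
  have hacc := h.acc_smaller.transGen
  clear h
  induction hacc with
  | intro t _ ih =>
    cases t with
    | var x => exact ⟨(spineTypable_var x).funTypable, fun _ => spineTypable_var x⟩
    | lam t => exact ⟨(ih t (.single (.inr (.lam t)))).1.lam, False.elim⟩
    | app s t =>
      have key : HeadVar s → SpineTypable (.app s t) := fun hs =>
        ((ih s (.single (.inr (.appL s t)))).2 hs).app (ih t (.single (.inr (.appR s t)))).1
      refine ⟨?_, key⟩
      rcases headVar_or_headStep s t with hs | ⟨u, r, h⟩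
      · exact (key hs).funTypable
      · refine .of_headStep h (ih r (.single (.inl h.toBeta))).1 (ih u ?_).1
        exact TransGen.mono (fun _ _ => Or.inr) _ _ h.subterm

end Term

namespace Term

/-- Structural beta normal forms; with the flag `true`, only those which are not
abstractions. -/
def IsNf : Bool → Term → Prop
  | _, var _ => True
  | _, app s t => IsNf true s ∧ IsNf false t
  | b, lam t => b = false ∧ IsNf false t

theorem BetaNormal.isNf {t : Term} (h : BetaNormal t) : IsNf false t := by
  induction t with
  | var n => trivial
  | lam t ih => exact ⟨rfl, ih fun u hu => h _ (.lam hu)⟩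
  | app s t ihs iht =>
    have hs := ihs fun u hu => h _ (.appL t hu)
    refine ⟨?_, iht fun u hu => h _ (.appR s hu)⟩
    cases s with
    | var n => trivial
    | app a b => exact hs
    | lam a => exact (h _ (.beta a t)).elim

theorem IsNf.lift {b : Bool} {t : Term} (h : IsNf b t) (d k : ℕ) : IsNf b (Term.lift d k t) := by
  induction t generalizing b k with
  | var n => simp only [Term.lift]; split_ifs <;> trivial
  | app s t ihs iht => exact ⟨ihs h.1 k, iht h.2 k⟩
  | lam t ih => exact ⟨h.1, ih h.2 (k + 1)⟩

/-- Every normal form is eta convertible to an abstraction with a normal body. -/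
theorem IsNf.exists_eta_expansion {t : Term} (h : IsNf false t) :
    ∃ r, IsNf false r ∧ Conv t (lam r) ∧
      ∀ Γ A B, BCD Γ t (.arrow A B) → BCD (A :: Γ) r B := by
  have key : IsNf true t → ∃ r, IsNf false r ∧ Conv t (lam r) ∧
      ∀ Γ A B, BCD Γ t (.arrow A B) → BCD (A :: Γ) r B := fun h' =>
    ⟨app (Term.lift 1 0 t) (var 0), ⟨h'.lift 1 0, trivial⟩, .symm (.rel (.inr (.eta t))),
      fun Γ A B hB => BCD.app (BCD.lift_one_iff.2 hB) (BCD.var rfl)⟩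
  cases t with
  | var n => exact key trivial
  | app s t => exact key h
  | lam t => exact ⟨t, h.2, .refl _, fun Γ A B hB => BCD.lam_arrow_iff.1 hB⟩

end Term

theorem List.eq_of_sum_map_le_one {α : Type*} {f : α → ℕ} {l : List α} (h : (l.map f).sum ≤ 1)
    {i j : ℕ} {p q : α} (hp : l[i]? = some p) (hq : l[j]? = some q) (hfp : 1 ≤ f p)
    (hfq : 1 ≤ f q) : i = j := by
  induction l generalizing i j with
  | nil => simp at hp
  | cons c l ih =>
    rw [List.map_cons, List.sum_cons] at h
    have mem_le : ∀ {r : α} {k : ℕ}, l[k]? = some r → f r ≤ (l.map f).sum := fun hr =>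
      List.le_sum_of_mem (List.mem_map_of_mem (List.mem_of_getElem? hr))
    cases i <;> cases j
    · rfl
    · simp only [List.getElem?_cons_zero, Option.some.injEq, List.getElem?_cons_succ] at hp hq
      subst hp
      have := mem_le hq
      omega
    · simp only [List.getElem?_cons_zero, Option.some.injEq, List.getElem?_cons_succ] at hp hq
      subst hq
      have := mem_le hp
      omega
    · rw [List.getElem?_cons_succ] at hp hq
      rw [ih (by omega) hp hq]

theorem List.sum_map_add_le {α : Type*} {f g : α → ℕ} {l : List α} (h : ∀ c ∈ l, f c ≤ g c)
    {c : α} (hc : c ∈ l) {d : ℕ} (hd : f c + d ≤ g c) :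
    (l.map f).sum + d ≤ (l.map g).sum := by
  induction l with
  | nil => simp at hc
  | cons b l ih =>
    simp only [List.map_cons, List.sum_cons]
    rcases List.mem_cons.1 hc with rfl | hc
    · have := List.sum_le_sum fun i hi => h i (List.mem_cons_of_mem c hi)
      omega
    · have := ih (fun i hi => h i (List.mem_cons_of_mem b hi)) hc
      have := h b List.mem_cons_self
      omega

namespace Ty

/-- The number of arrows in a type. -/
def weight : Ty → ℕ
  | atom _ => 0
  | arrow A B => weight A + weight B + 1
  | inter A B => weight A + weight B

/-- The atom at the end of a type that is not an intersection. -/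
def endAtom : Ty → ℕ
  | atom a => a
  | arrow _ B => endAtom B
  | inter _ _ => 0

theorem CSub.endAtom_eq {C D : Ty} (h : CSub C D) : endAtom C = endAtom D := by
  induction h with
  | atom a => rfl
  | arrow _ _ ih => exact ih

theorem endAtom_arrows (l : List Ty) (A : Ty) : endAtom (arrows l A) = endAtom A := by
  induction l with
  | nil => rfl
  | cons D l ih => exact ih

theorem arrows_atom_injective {l l' : List Ty} {a : ℕ}
    (h : arrows l (atom a) = arrows l' (atom a)) : l = l' := by
  induction l generalizing l' with
  | nil => cases l' <;> simp_all [arrows]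
  | cons D l ih =>
    cases l' with
    | nil => simp [arrows] at h
    | cons D' l' =>
      simp only [arrows, List.foldr_cons, arrow.injEq] at h
      rw [h.1, ih h.2]

theorem occ_le_of_mem_comps {A C : Ty} (h : C ∈ comps A) (a : ℕ) (s : Bool) :
    occ a s C ≤ occ a s A := by
  induction A generalizing C with
  | atom b => simp only [comps, List.mem_singleton] at h; rw [h]
  | arrow A B _ ih =>
    obtain ⟨D, hD, rfl⟩ := List.mem_map.1 h
    exact Nat.add_le_add_left (ih hD) _
  | inter A B iha ihb =>
    simp only [occ]
    rcases List.mem_append.1 h with h | h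
    · exact (iha h).trans (Nat.le_add_right _ _)
    · exact (ihb h).trans (Nat.le_add_left _ _)

theorem one_le_occ_endAtom {A C : Ty} (h : C ∈ comps A) : 1 ≤ occ (endAtom C) true C := by
  induction A generalizing C with
  | atom b => simp only [comps, List.mem_singleton] at h; simp [h, occ, endAtom]
  | arrow A B _ ih =>
    obtain ⟨D, hD, rfl⟩ := List.mem_map.1 h
    exact (ih hD).trans (Nat.le_add_left _ _)
  | inter A B iha ihb => exact (List.mem_append.1 h).elim iha ihb

theorem Good.comps_eq {s : Bool} {A : Ty} (h : Good s A) (hA : ¬ IsInter A) : comps A = [A] := by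
  induction A generalizing s with
  | atom b => rfl
  | arrow A B _ ih => simp [comps, ih h.2.1 h.2.2]
  | inter A B => exact (hA trivial).elim

theorem Good.sum_occ_comps {A : Ty} (h : Good false A) (a : ℕ) (s : Bool) :
    ((comps A).map (occ a s)).sum = occ a s A := by
  induction A with
  | atom b => simp [comps]
  | arrow A B => simp [h.comps_eq (A := arrow A B) id]
  | inter A B iha ihb => simp [comps, occ, iha h.2.1, ihb h.2.2]

/-- Replace every component of the form `D₁ → ... → Dₙ → a` by `a`. -/
def prune (a : ℕ) : Ty → Ty
  | atom b => atom b
  | arrow A B => if endAtom B = a then atom a else arrow A B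
  | inter A B => inter (prune a A) (prune a B)

theorem Good.prune {A : Ty} (h : Good false A) (a : ℕ) : Good false (prune a A) := by
  induction A with
  | atom b => trivial
  | arrow A B => simp only [Ty.prune]; split_ifs; exacts [trivial, h]
  | inter A B iha ihb => exact ⟨rfl, iha h.2.1, ihb h.2.2⟩

theorem Good.mem_comps_prune {A C : Ty} (h : Good false A) (hC : C ∈ comps A) {a : ℕ}
    (ha : endAtom C ≠ a) : C ∈ comps (Ty.prune a A) := by
  induction A with
  | atom b => exact hC
  | arrow A B =>
    have hC' := hC
    rw [h.comps_eq (A := arrow A B) id, List.mem_singleton] at hC'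
    subst hC'
    rwa [Ty.prune, if_neg (show endAtom B ≠ a from ha)]
  | inter A B iha ihb =>
    exact List.mem_append.2 ((List.mem_append.1 hC).imp (iha h.2.1) (ihb h.2.2))

theorem Good.occ_prune_le {A : Ty} (h : Good false A) (a b : ℕ) (s : Bool) :
    occ b s (Ty.prune a A) ≤ occ b s A := by
  induction A with
  | atom c => rfl
  | arrow A B =>
    simp only [Ty.prune]
    split_ifs with he
    · have := one_le_occ_endAtom (A := arrow A B) (C := arrow A B)
        (by simp [h.comps_eq (A := arrow A B) id])
      simp only [endAtom, he] at this
      cases s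
      · simp [occ]
      · by_cases hb : b = a
        · subst hb; simpa [occ] using this
        · simp [occ, hb]
    · rfl
  | inter A B iha ihb => exact Nat.add_le_add (iha h.2.1) (ihb h.2.2)

theorem weight_prune_le (A : Ty) (a : ℕ) : weight (prune a A) ≤ weight A := by
  induction A with
  | atom c => rfl
  | arrow A B => simp only [prune]; split_ifs <;> simp [weight]
  | inter A B iha ihb => exact Nat.add_le_add iha ihb

theorem occ_arrows {l : List Ty} {D : Ty} (h : D ∈ l) (A : Ty) (b : ℕ) (s : Bool) :
    occ b s A + occ b (!s) D ≤ occ b s (arrows l A) := by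
  have key : ∀ l, occ b s A ≤ occ b s (arrows l A) := fun l => by
    induction l with
    | nil => rfl
    | cons E l ih => exact ih.trans (Nat.le_add_left _ _)
  induction l with
  | nil => simp at h
  | cons E l ih =>
    change _ ≤ occ b (!s) E + occ b s (arrows l A)
    rcases List.mem_cons.1 h with rfl | h
    · have := key l; omega
    · have := ih h; omega

theorem weight_arrows {l : List Ty} {D : Ty} (h : D ∈ l) (A : Ty) :
    weight D < weight (arrows l A) := by
  induction l with
  | nil => simp at h
  | cons E l ih =>
    change _ < weight E + weight (arrows l A) + 1
    rcases List.mem_cons.1 h with rfl | h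
    · omega
    · have := ih h; omega

theorem Good.of_mem_arrows {l : List Ty} {A D : Ty} (h : Good false (arrows l A)) (hD : D ∈ l) :
    Good true D := by
  induction l with
  | nil => simp at hD
  | cons E l ih =>
    rcases List.mem_cons.1 hD with rfl | hD
    · exact h.1
    · exact ih h.2.1 hD

theorem Good.of_mem_comps {A C : Ty} (h : Good false A) (hC : C ∈ comps A) : Good false C := by
  induction A with
  | atom b => rw [List.mem_singleton.1 hC]; trivial
  | arrow A B =>
    rw [h.comps_eq (A := arrow A B) id, List.mem_singleton] at hC
    rwa [hC]
  | inter A B iha ihb => exact (List.mem_append.1 hC).elim (iha h.2.1) (ihb h.2.2)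

theorem Good.prune_add_le {A D : Ty} {l : List Ty} {a : ℕ} (h : Good false A)
    (hl : arrows l (atom a) ∈ comps A) (hD : D ∈ l) :
    (∀ b s, occ b s (Ty.prune a A) + occ b (!s) D ≤ occ b s A) ∧
      weight (Ty.prune a A) + (weight D + 1) ≤ weight A := by
  induction A with
  | atom b =>
    have h1 := weight_arrows hD (atom a)
    rw [List.mem_singleton.1 hl] at h1
    simp [weight] at h1
  | arrow A B =>
    rw [h.comps_eq (A := arrow A B) id, List.mem_singleton] at hl
    have he := endAtom_arrows l (atom a)
    rw [hl] at he
    rw [Ty.prune, if_pos (show endAtom B = a from he), ← hl]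
    refine ⟨occ_arrows hD _, ?_⟩
    have := weight_arrows hD (atom a)
    simp only [weight] at *
    omega
  | inter A B iha ihb =>
    simp only [Ty.prune, occ, weight]
    have hA := h.2.1.occ_prune_le a
    have hB := h.2.2.occ_prune_le a
    have hwA := weight_prune_le A a
    have hwB := weight_prune_le B a
    rcases List.mem_append.1 hl with hl | hl
    · obtain ⟨h1, h2⟩ := iha h.2.1 hl
      exact ⟨fun b s => by have := h1 b s; have := hB b s; omega, by omega⟩
    · obtain ⟨h1, h2⟩ := ihb h.2.2 hl
      exact ⟨fun b s => by have := h1 b s; have := hA b s; omega, by omega⟩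

theorem comp_unique {Γ : List Ty} {a x y : ℕ} {B B' C C' : Ty} (hΓ : ∀ B ∈ Γ, Good false B)
    (ha : ctxOcc a true Γ ≤ 1) (hx : Γ[x]? = some B) (hy : Γ[y]? = some B') (hC : C ∈ comps B)
    (hC' : C' ∈ comps B') (h : 1 ≤ occ a true C) (h' : 1 ≤ occ a true C') :
    x = y ∧ B = B' ∧ C = C' := by
  have hxy := List.eq_of_sum_map_le_one ha hx hy (h.trans (occ_le_of_mem_comps hC _ _))
    (h'.trans (occ_le_of_mem_comps hC' _ _))
  subst hxy
  obtain rfl : B = B' := by rw [hx] at hy; exact Option.some.inj hy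
  have hB := List.mem_of_getElem? hx
  have hs : ((comps B).map (occ a true)).sum ≤ 1 :=
    ((hΓ B hB).sum_occ_comps a true).trans_le
      ((List.le_sum_of_mem (List.mem_map_of_mem hB)).trans ha)
  obtain ⟨i, hi⟩ := List.getElem?_of_mem hC
  obtain ⟨j, hj⟩ := List.getElem?_of_mem hC'
  obtain rfl := List.eq_of_sum_map_le_one hs hi hj h h'
  rw [hi] at hj
  exact ⟨rfl, rfl, Option.some.inj hj⟩

end Ty

namespace BCD

open Ty Term

variable {Γ Δ : List Ty} {s t : Term} {A B C : Ty}

/-- Typing of a neutral term by a component, read off along the spine from a component of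
the type of the head variable. -/
def NeutralTy (Γ : List Ty) : Term → Ty → Prop
  | .var n, C => ∃ B, Γ[n]? = some B ∧ C ∈ comps B
  | .app s t, C => ∃ E, NeutralTy Γ s (arrow E C) ∧ BCD Γ t E
  | .lam _, _ => False

theorem NeutralTy.bcd (h : NeutralTy Γ t C) : BCD Γ t C := by
  induction t generalizing C with
  | var n => obtain ⟨B, h1, h2⟩ := h; exact (BCD.var h1).sub (sub_of_mem_comps h2)
  | app s t ihs _ => obtain ⟨E, h1, h2⟩ := h; exact (ihs h1).app h2
  | lam t => exact h.elim

theorem exists_neutralTy (ht : IsNf true t) (h : BCD Γ t A) {D : Ty} (hD : D ∈ comps A) :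
    ∃ C, NeutralTy Γ t C ∧ CSub C D := by
  induction t generalizing A D with
  | var n =>
    obtain ⟨B, h1, h2⟩ := var_iff.1 h
    obtain ⟨C, hC, hCD⟩ := h2.comps D hD
    exact ⟨C, ⟨B, h1, hC⟩, hCD⟩
  | app s t ihs _ =>
    obtain ⟨B, h1, h2⟩ := app_iff.1 h
    obtain ⟨C, hC, hCD⟩ := ihs ht.1 h1 (D := arrow B D) (List.mem_map_of_mem hD)
    cases hCD with
    | arrow h3 h4 => exact ⟨_, ⟨_, hC, h2.sub h3⟩, h4⟩
  | lam t => exact absurd ht.1 (by simp)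

/-- Every component in `Γ` that does not end in `a` is free of `a` and is available in `Δ`. -/
def Avoids (a : ℕ) (Γ Δ : List Ty) : Prop :=
  ∀ (n : ℕ) B, Γ[n]? = some B → ∃ B', Δ[n]? = some B' ∧
    ∀ C ∈ comps B, endAtom C ≠ a → C ∈ comps B' ∧ ∀ s, occ a s C = 0

theorem Avoids.cons {a : ℕ} (h : Avoids a Γ Δ) (hA : ∀ s, occ a s A = 0) :
    Avoids a (A :: Γ) (A :: Δ) := by
  intro n B hB
  cases n with
  | zero =>
    simp only [List.getElem?_cons_zero, Option.some.injEq] at hB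
    subst hB
    exact ⟨A, rfl, fun C hC _ =>
      ⟨hC, fun s => Nat.le_zero.1 ((occ_le_of_mem_comps hC a s).trans (hA s).le)⟩⟩
  | succ n => exact h n B hB

theorem avoid {a : ℕ} (hΓ : Avoids a Γ Δ) :
    (IsNf false t → (∀ s, occ a s A = 0) → BCD Γ t A → BCD Δ t A) ∧
    (IsNf true t → endAtom C ≠ a → NeutralTy Γ t C → NeutralTy Δ t C ∧ ∀ s, occ a s C = 0) := by
  have neutral : ∀ {t : Term} {Γ Δ A},
      (∀ C, endAtom C ≠ a → NeutralTy Γ t C → NeutralTy Δ t C ∧ ∀ s, occ a s C = 0) →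
      IsNf true t → (∀ s, occ a s A = 0) → BCD Γ t A → BCD Δ t A := by
    intro t Γ Δ A H ht hA h
    refine of_comps fun D hD => ?_
    obtain ⟨C, hC, hCD⟩ := exists_neutralTy ht h hD
    refine ⟨C, (H C (fun hCa => ?_) hC).1.bcd, hCD.sub⟩
    have h1 := (one_le_occ_endAtom hD).trans (occ_le_of_mem_comps hD _ _)
    rw [← hCD.endAtom_eq, hCa, hA] at h1
    exact absurd h1 (by simp)
  induction t generalizing Γ Δ A C with
  | var n =>
    have H : ∀ C, endAtom C ≠ a → NeutralTy Γ (.var n) C →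
        NeutralTy Δ (.var n) C ∧ ∀ s, occ a s C = 0 := by
      rintro C hC ⟨B, h1, h2⟩
      obtain ⟨B', h3, h4⟩ := hΓ n B h1
      exact ⟨⟨B', h3, (h4 C h2 hC).1⟩, (h4 C h2 hC).2⟩
    exact ⟨fun _ => neutral H trivial, fun _ => H C⟩
  | app s t ihs iht =>
    have H : IsNf false (.app s t) → ∀ C, endAtom C ≠ a → NeutralTy Γ (.app s t) C →
        NeutralTy Δ (.app s t) C ∧ ∀ s, occ a s C = 0 := by
      rintro hst C hC ⟨E, h1, h2⟩
      obtain ⟨h3, h4⟩ := (ihs (A := C) (C := arrow E C) hΓ).2 hst.1 hC h1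
      simp only [occ, Nat.add_eq_zero_iff] at h4
      have hE : ∀ s, occ a s E = 0 := fun s => by simpa using (h4 (!s)).1
      exact ⟨⟨E, h3, (iht (C := C) hΓ).1 hst.2 hE h2⟩, fun s => (h4 s).2⟩
    exact ⟨fun hst => neutral (H hst) hst, fun hst => H hst C⟩
  | lam t ih =>
    refine ⟨fun ht hA h => lam_iff.2 ?_, fun _ _ h => h.elim⟩
    replace h := lam_iff.1 h
    induction A with
    | atom b => exact h
    | arrow A B =>
      simp only [occ, Nat.add_eq_zero_iff] at hA
      exact (ih (C := B) (hΓ.cons fun s => by simpa using (hA (!s)).1)).1 ht.2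
        (fun s => (hA s).2) h
    | inter A B iha ihb =>
      simp only [occ, Nat.add_eq_zero_iff] at hA
      exact ⟨iha (fun s => (hA s).1) h.1, ihb (fun s => (hA s).2) h.2⟩

/-- `Spine Γ x l t` : `t` is the variable `x` applied to normal arguments, whose types, from the
last to the first, are those in `l`. -/
def Spine (Γ : List Ty) (x : ℕ) : List Ty → Term → Prop
  | [], t => t = .var x
  | D :: l, t => ∃ s u, t = .app s u ∧ Spine Γ x l s ∧ IsNf false u ∧ BCD Γ u D

theorem NeutralTy.exists_spine (ht : IsNf true t) (h : NeutralTy Γ t C) :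
    ∃ x B l, Γ[x]? = some B ∧ arrows l.reverse C ∈ comps B ∧ Spine Γ x l t := by
  induction t generalizing C with
  | var n => obtain ⟨B, h1, h2⟩ := h; exact ⟨n, B, [], h1, h2, rfl⟩
  | app s t ihs _ =>
    obtain ⟨E, h1, h2⟩ := h
    obtain ⟨x, B, l, h3, h4, h5⟩ := ihs ht.1 h1
    exact ⟨x, B, E :: l, h3, by simpa [arrows] using h4, s, t, rfl, h5, ht.2, h2⟩
  | lam t => exact h.elim

theorem Spine.conv {x : ℕ} {l : List Ty} (hs : Spine Γ x l s) (ht : Spine Γ x l t)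
    (h : ∀ D ∈ l, ∀ s t, IsNf false s → IsNf false t → BCD Γ s D → BCD Γ t D → Conv s t) :
    Conv s t := by
  induction l generalizing s t with
  | nil => rw [show s = .var x from hs, show t = .var x from ht]; exact .refl _
  | cons D l ih =>
    obtain ⟨s, u, rfl, h1, h2, h3⟩ := hs
    obtain ⟨s', u', rfl, h1', h2', h3'⟩ := ht
    exact (ih h1 h1' fun D hD => h D (List.mem_cons_of_mem _ hD)).app
      (h D List.mem_cons_self _ _ h2 h2' h3 h3')

theorem _root_.Ty.FunSeq.avoids {a x : ℕ} {l : List Ty} (h : FunSeq Γ (atom a)) (hx : Γ[x]? = some B)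
    (hl : arrows l (atom a) ∈ comps B) : Avoids a Γ (Γ.map (prune a)) := by
  intro n B' hB'
  refine ⟨prune a B', by simp [hB'], fun C hC hCa =>
    ⟨(h.ctx B' (List.mem_of_getElem? hB')).mem_comps_prune hC hCa, fun s => ?_⟩⟩
  have he : endAtom (arrows l (atom a)) = a := endAtom_arrows l _
  cases s with
  | false =>
    have h1 := h.occ_le a true
    have h2 : occ a false B' ≤ ctxOcc a false Γ :=
      List.le_sum_of_mem (List.mem_map_of_mem (List.mem_of_getElem? hB'))
    have h3 := occ_le_of_mem_comps hC a false
    simp [occ] at h1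
    omega
  | true =>
    by_contra h0
    have h1 := one_le_occ_endAtom hl
    rw [he] at h1
    obtain ⟨-, -, rfl⟩ := comp_unique h.ctx (by simpa [occ] using h.occ_le a false) hB' hx hC hl
      (Nat.one_le_iff_ne_zero.2 h0) h1
    exact hCa he

theorem _root_.Ty.FunSeq.prune {a : ℕ} {l : List Ty} {D : Ty} (h : FunSeq Γ (atom a)) (hB : B ∈ Γ)
    (hl : arrows l (atom a) ∈ comps B) (hD : D ∈ l) : FunSeq (Γ.map (prune a)) D where
  ctx C hC := by
    obtain ⟨E, hE, rfl⟩ := List.mem_map.1 hC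
    exact (h.ctx E hE).prune a
  goal := ((h.ctx B hB).of_mem_comps hl).of_mem_arrows hD
  occ_le b s := by
    have h1 := ((h.ctx B hB).prune_add_le hl hD).1 b (!s)
    rw [Bool.not_not] at h1
    have h2 := List.sum_map_add_le
      (fun C hC => (h.ctx C hC).occ_prune_le a b (!s)) hB h1
    have h3 := h.occ_le b s
    simp only [ctxOcc, List.map_map] at *
    exact h2.trans (by omega)

/-- Normal terms with the same functional type are beta-eta convertible. -/
theorem conv_of_funSeq (h : FunSeq Γ A) (hs : IsNf false s) (ht : IsNf false t)
    (hsA : BCD Γ s A) (htA : BCD Γ t A) : Conv s t := by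
  induction hw : (Γ.map weight).sum + weight A using Nat.strong_induction_on
    generalizing Γ A s t with
  | _ w ih =>
    subst hw
    cases A with
    | inter A B => exact absurd h.goal.1 (by simp)
    | arrow A B =>
      obtain ⟨r, hr, hsr, hrB⟩ := hs.exists_eta_expansion
      obtain ⟨r', hr', htr', hrB'⟩ := ht.exists_eta_expansion
      have hAB : FunSeq (A :: Γ) B :=
        { ctx := List.forall_mem_cons.2 ⟨h.goal.1, h.ctx⟩
          goal := h.goal.2.1
          occ_le := fun a s => by
            have := h.occ_le a s
            simp only [occ, ctxOcc, List.map_cons, List.sum_cons] at *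
            omega }
      refine hsr.trans (.trans (Conv.lam ?_) htr'.symm)
      refine ih _ ?_ hAB hr hr' (hrB _ _ _ hsA) (hrB' _ _ _ htA) rfl
      simp only [weight, List.map_cons, List.sum_cons]
      omega
    | atom a =>
      have spine : ∀ {r : Term}, IsNf false r → BCD Γ r (atom a) → ∃ x B l,
          Γ[x]? = some B ∧ arrows l.reverse (atom a) ∈ comps B ∧ Spine Γ x l r := by
        intro r hr hra
        have hr' : IsNf true r := by
          cases r with
          | var n => trivial
          | app p q => exact hr
          | lam p => exact (lam_iff.1 hra).elim
        obtain ⟨C, hC, hCa⟩ := exists_neutralTy hr' hra (D := atom a) (by simp [comps])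
        cases hCa
        exact hC.exists_spine hr'
      obtain ⟨x, B, l, hx, hl, hsp⟩ := spine hs hsA
      obtain ⟨y, B', l', hy, hl', hsp'⟩ := spine ht htA
      have hend : ∀ {l : List Ty} {B : Ty}, arrows l (atom a) ∈ comps B →
          1 ≤ occ a true (arrows l (atom a)) := fun {l} _ hl => by
        simpa only [endAtom_arrows, endAtom] using one_le_occ_endAtom hl
      obtain ⟨rfl, -, hll⟩ := comp_unique h.ctx (by simpa [occ] using h.occ_le a false) hx hy hl hl'
        (hend hl) (hend hl')
      obtain rfl := List.reverse_injective (arrows_atom_injective hll)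
      refine hsp.conv hsp' fun D hD p q hp hq hpD hqD => ?_
      have hD' := List.mem_reverse.2 hD
      have hB := List.mem_of_getElem? hx
      have hav := h.avoids hx hl
      have hw := List.sum_map_add_le (fun C _ => weight_prune_le C a) hB
        ((h.ctx B hB).prune_add_le hl hD').2
      have hDa : ∀ s, occ a s D = 0 := by
        intro s
        have h1 := occ_arrows hD' (atom a) a (!s)
        have h2 := (occ_le_of_mem_comps hl a (!s)).trans
          (List.le_sum_of_mem (List.mem_map_of_mem hB))
        have h3 := h.occ_le a s
        rw [Bool.not_not] at h1
        simp only [ctxOcc] at h3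
        cases s <;> simp only [occ, Bool.not_true, Bool.not_false, if_true] at * <;> simp at * <;> omega
      refine ih _ ?_ (h.prune hB hl hD') hp hq ((avoid (C := D) hav).1 hp hDa hpD)
        ((avoid (C := D) hav).1 hq hDa hqD) rfl
      simp only [List.map_map, weight]
      exact Nat.lt_of_lt_of_le (Nat.lt_succ_self _) (hw.trans (Nat.le_add_right _ _))

end BCD

/-- For every strongly normalizable untyped lambda term `M` with
beta-eta normal form `N`, there exists a functional intersection type `A` such
that `⊢ M : A` in BCD, and `N` is the unique term in beta-eta normal form with
`⊢ N : A` in BCD. -/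
theorem functional_type_for_SN_term (M N : Term)
    (hM : Term.Closed M) (hSN : Term.SN M)
    (hN : Term.BetaEtaNormal N) (hMN : Term.Conv M N) :
    ∃ A : Ty, Ty.Functional A ∧ BCD [] M A ∧ BCD [] N A ∧
      ∀ N' : Term, Term.BetaEtaNormal N' → BCD [] N' A → N' = N := by
  obtain ⟨Γ, A, m, -, hΓ, hMA, hA, -⟩ := hSN.funTypable 0 0 hM
  obtain rfl := List.length_eq_zero_iff.1 hΓ
  have hNA := BCD.betaEta (hMN.reduces hN) hMA
  have isNf : ∀ {t : Term}, Term.BetaEtaNormal t → Term.IsNf false t :=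
    fun ht => Term.BetaNormal.isNf fun u hu => ht u (.inl hu)
  exact ⟨A, hA.functional, hMA, hNA, fun N' hN' hA' =>
    (BCD.conv_of_funSeq hA (isNf hN') (isNf hN) hA' hNA).eq_of_normal hN' hN⟩
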